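/- Let Ω ⊂ ℝ^m be a domain, let ψ be a lower semicontinuous function on Ω, and let 𝓕 be a nonempty family of upper semicontinuous functions on Ω that is locally uniformly bounded above and such that Δ̄φ ≥ ψ on Ω for every φ ∈ 𝓕. Let φ*(x) := limsup_{y→x} sup_{φ∈𝓕} φ(y) be the upper semicontinuous regularization of the pointwise supremum of the family. Then Δ̄φ* ≥ ψ on Ω. -/

import Mathlib

open MeasureTheory Metric Filter Topology Set
open scoped ENNReal

noncomputable section

/-- The positive part of an extended real number, as an extended nonnegative real. -/
def erealToENNReal (x : EReal) : ℝ≥0∞ := if x = ⊤ then ⊤ else ENNReal.ofReal x.toReal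

variable {E : Type*} [NormedAddCommGroup E] [MeasureSpace E]

/-- The mean value `M_u(x,r)` of an extended-real-valued function `u` over the ball `B(x,r)`,
computed as the difference of the integrals of the positive and negative parts. -/
def erealBallAvg (u : E → EReal) (x : E) (r : ℝ) : EReal :=
  (((∫⁻ y in ball x r, erealToENNReal (u y)) / volume (ball x r) : ℝ≥0∞) : EReal)
    - (((∫⁻ y in ball x r, erealToENNReal (-(u y))) / volume (ball x r) : ℝ≥0∞) : EReal)

/-- The sub-mean value property on a set `s`: at each point of `s` the value of `u` is at most
its average over every sufficiently small ball centered at the point and contained in `s`. -/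
def SubmeanOn (u : E → EReal) (s : Set E) : Prop :=
  ∀ x ∈ s, ∃ R > 0, ∀ r : ℝ, 0 < r → r < R → closedBall x r ⊆ s →
    u x ≤ erealBallAvg u x r

/-- `u : E → [-∞,∞)` is subharmonic on `s` if it is upper semicontinuous on `s`, not
identically `-∞` on `s`, takes values in `[-∞,∞)`, and satisfies the sub-mean value
inequality on `s`. -/
def IsSubharmonicOn (u : E → EReal) (s : Set E) : Prop :=
  UpperSemicontinuousOn u s ∧ (¬ ∀ x ∈ s, u x = ⊥) ∧ (∀ x ∈ s, u x < ⊤) ∧ SubmeanOn u s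

/-- The generalized upper Laplace parameter (upper Privalov operator)
`Δ̄u(x) = 2(m+2) · limsup_{r→0⁺} (M_u(x,r) - u(x))/r²`. -/
def upperLaplace (m : ℕ) (u : E → EReal) (x : E) : EReal :=
  ((2 * ((m : ℝ) + 2) : ℝ) : EReal) *
    Filter.limsup (fun r : ℝ => (((r ^ 2)⁻¹ : ℝ) : EReal) * (erealBallAvg u x r - u x))
      (𝓝[>] (0 : ℝ))

theorem continuousOn_comp_add {F : Type*} [NormedAddCommGroup F] {g : F → ℝ} {y : F} {r : ℝ}
    (hg : ContinuousOn g (closedBall y r)) :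
    ContinuousOn (fun h => g (y + h)) (closedBall 0 r) :=
  hg.comp (by fun_prop) fun h hh => by simpa using hh

section Supremum

variable {F : Type*} [PseudoMetricSpace F]

/-- The sup-convolution of `s` on the set `A`, with slope `n`, after truncation at level `-n`. -/
def supConv (s : F → EReal) (A : Set F) (n : ℕ) (y : F) : ℝ :=
  ⨆ z : A, ((max (s z) ((-n : ℝ) : EReal)).toReal - n * dist y z)

theorem toReal_max_coe_le {x : EReal} {b a : ℝ} (hx : x ≤ a) (hb : b ≤ a) :
    (max x (b : EReal)).toReal ≤ a :=
  EReal.toReal_le_toReal (y := a) (max_le hx (EReal.coe_le_coe_iff.2 hb))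
    (ne_bot_of_le_ne_bot (EReal.coe_ne_bot b) (le_max_right _ _)) (EReal.coe_ne_top _)

variable {s : F → EReal} {A : Set F} {C : ℝ}

theorem bddAbove_supConv (hC : 0 ≤ C) (hs : ∀ z ∈ A, s z ≤ C) (n : ℕ) (y : F) :
    BddAbove (range fun z : A => (max (s z) ((-n : ℝ) : EReal)).toReal - n * dist y z) := by
  refine ⟨C, ?_⟩
  rintro _ ⟨z, rfl⟩
  have h1 := toReal_max_coe_le (hs z z.2) (b := -n) (by linarith [n.cast_nonneg (α := ℝ)])
  have : 0 ≤ n * dist y z := by positivity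
  simp only
  linarith

theorem supConv_le_of_forall (hA : A.Nonempty) {n : ℕ} {y : F} {a : ℝ}
    (h : ∀ z ∈ A, (max (s z) ((-n : ℝ) : EReal)).toReal - n * dist y z ≤ a) :
    supConv s A n y ≤ a := by
  have := hA.to_subtype
  exact ciSup_le fun z => h z z.2

theorem supConv_le (hA : A.Nonempty) (hC : 0 ≤ C) (hs : ∀ z ∈ A, s z ≤ C) (n : ℕ) (y : F) :
    supConv s A n y ≤ C := by
  refine supConv_le_of_forall hA fun z hz => ?_
  have h1 := toReal_max_coe_le (hs z hz) (b := -n) (by linarith [n.cast_nonneg (α := ℝ)])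
  have : 0 ≤ n * dist y z := by positivity
  linarith

theorem lipschitzWith_supConv (hA : A.Nonempty) (hC : 0 ≤ C) (hs : ∀ z ∈ A, s z ≤ C) (n : ℕ) :
    LipschitzWith n (supConv s A n) := by
  refine LipschitzWith.of_le_add_mul _ fun y y' => supConv_le_of_forall hA fun z hz => ?_
  have h1 := le_ciSup (bddAbove_supConv hC hs n y') ⟨z, hz⟩
  have h2 := dist_triangle y' y z
  rw [dist_comm y' y] at h2
  have h3 : (n : ℝ) * dist y' z ≤ n * (dist y y' + dist y z) := by gcongr
  simp only [NNReal.coe_natCast]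
  simp only [supConv] at h1 ⊢
  linarith

theorem le_supConv (hC : 0 ≤ C) (hs : ∀ z ∈ A, s z ≤ C) (n : ℕ) {y : F} (hy : y ∈ A) :
    s y ≤ (supConv s A n y : EReal) := by
  have h1 := le_ciSup (bddAbove_supConv hC hs n y) ⟨y, hy⟩
  simp only [dist_self, mul_zero, sub_zero] at h1
  refine (le_max_left _ ((-n : ℝ) : EReal)).trans
    ((EReal.le_coe_toReal ?_).trans (EReal.coe_le_coe_iff.2 h1))
  exact (max_lt ((hs y hy).trans_lt (EReal.coe_lt_top _)) (EReal.coe_lt_top _)).ne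

theorem eventually_supConv_le (hA : A.Nonempty) (hC : 0 ≤ C) (hs : ∀ z ∈ A, s z ≤ C) {y : F}
    {a : ℝ} (h : ∀ᶠ z in 𝓝 y, s z ≤ a) : ∀ᶠ n in atTop, supConv s A n y ≤ a := by
  obtain ⟨δ, hδ, h⟩ := Metric.eventually_nhds_iff.1 h
  have h1 : ∀ᶠ n : ℕ in atTop, -a ≤ n := tendsto_natCast_atTop_atTop.eventually_ge_atTop _
  have h2 : ∀ᶠ n : ℕ in atTop, (C - a) / δ ≤ n :=
    tendsto_natCast_atTop_atTop.eventually_ge_atTop _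
  filter_upwards [h1, h2] with n h1 h2
  rw [div_le_iff₀ hδ] at h2
  refine supConv_le_of_forall hA fun z hz => ?_
  rcases lt_or_ge (dist y z) δ with h3 | h3
  · have h4 := toReal_max_coe_le (h (by rwa [dist_comm])) (b := -n) (by linarith)
    have : 0 ≤ n * dist y z := by positivity
    linarith
  · have h4 := toReal_max_coe_le (hs z hz) (b := -n) (by linarith [n.cast_nonneg (α := ℝ)])
    have : n * δ ≤ n * dist y z := by gcongr
    linarith

/-- The upper semicontinuous regularization on `Ω` of the pointwise supremum of a family. -/
def uscSup (Ω : Set F) (𝓕 : Set (F → EReal)) (x : F) : EReal :=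
  limsup (fun y => ⨆ φ ∈ 𝓕, φ y) (𝓝[Ω] x)

variable {Ω : Set F} {𝓕 : Set (F → EReal)} {x : F}

theorem le_uscSup {φ : F → EReal} (hφ : φ ∈ 𝓕) (hx : x ∈ Ω) : φ x ≤ uscSup Ω 𝓕 x := by
  have h : ∃ᶠ y in pure x, (⨆ φ ∈ 𝓕, φ x) ≤ ⨆ φ ∈ 𝓕, φ y :=
    (eventually_pure.2 le_rfl).frequently
  exact (le_iSup₂ (f := fun φ (_ : φ ∈ 𝓕) => φ x) φ hφ).trans
    (le_limsup_of_frequently_le (h.filter_mono (pure_le_nhdsWithin hx)) (by isBoundedDefault))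

theorem uscSup_lt_top
    (hbd : ∃ V ∈ 𝓝 x, ∃ C : ℝ, ∀ φ ∈ 𝓕, ∀ y ∈ V, φ y ≤ (C : EReal)) :
    uscSup Ω 𝓕 x < ⊤ := by
  obtain ⟨V, hV, C, hC⟩ := hbd
  refine lt_of_le_of_lt (limsup_le_of_le (by isBoundedDefault) ?_) (EReal.coe_lt_top C)
  filter_upwards [mem_nhdsWithin_of_mem_nhds hV] with y hy
  exact iSup₂_le fun φ hφ => hC φ hφ y hy

end Supremum

section BallMean

variable {F : Type*} [NormedAddCommGroup F] [InnerProductSpace ℝ F] [FiniteDimensional ℝ F]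
  [MeasurableSpace F] [BorelSpace F]

local notation "⟪" x ", " y "⟫" => inner ℝ x y

/-- The mean value of a real function over a ball. -/
def ballMean (g : F → ℝ) (y : F) (r : ℝ) : ℝ := ⨍ h in ball (0 : F) r, g (y + h)

/-- The mean value of the squared norm over the unit ball. -/
def normSqMean (F : Type*) [NormedAddCommGroup F] [InnerProductSpace ℝ F] [FiniteDimensional ℝ F]
    [MeasurableSpace F] [BorelSpace F] : ℝ := ⨍ h in ball (0 : F) 1, ‖h‖ ^ 2

theorem integrableOn_ball_of_continuousOn {g : F → ℝ} {y : F} {r : ℝ}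
    (hg : ContinuousOn g (closedBall y r)) : IntegrableOn g (ball y r) :=
  (hg.integrableOn_compact (isCompact_closedBall y r)).mono_set ball_subset_closedBall

theorem integrableOn_ball_comp_add {g : F → ℝ} {y : F} {r : ℝ}
    (hg : ContinuousOn g (closedBall y r)) :
    IntegrableOn (fun h => g (y + h)) (ball 0 r) :=
  integrableOn_ball_of_continuousOn (continuousOn_comp_add hg)

theorem volume_real_ball_pos (y : F) {r : ℝ} (hr : 0 < r) : 0 < volume.real (ball y r) :=
  ENNReal.toReal_pos (measure_ball_pos volume y hr).ne' measure_ball_lt_top.ne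

theorem setAverage_add {g₁ g₂ : F → ℝ} {s : Set F} (h₁ : IntegrableOn g₁ s)
    (h₂ : IntegrableOn g₂ s) :
    ⨍ h in s, (g₁ h + g₂ h) = (⨍ h in s, g₁ h) + ⨍ h in s, g₂ h := by
  simp only [setAverage_eq, smul_eq_mul]
  rw [integral_add h₁ h₂, mul_add]

theorem setAverage_const_mul (c : ℝ) (g : F → ℝ) (s : Set F) :
    ⨍ h in s, c * g h = c * ⨍ h in s, g h := by
  simp only [setAverage_eq, smul_eq_mul, integral_const_mul]
  ring

theorem setAverage_ball_const {r : ℝ} (hr : 0 < r) (c : ℝ) :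
    ⨍ _ in ball (0 : F) r, c = c :=
  setAverage_const (measure_ball_pos volume _ hr).ne' measure_ball_lt_top.ne c

theorem setAverage_mono {g₁ g₂ : F → ℝ} {s : Set F} (hs : MeasurableSet s)
    (h₁ : IntegrableOn g₁ s) (h₂ : IntegrableOn g₂ s) (h : ∀ x ∈ s, g₁ x ≤ g₂ x) :
    ⨍ h in s, g₁ h ≤ ⨍ h in s, g₂ h := by
  simp only [setAverage_eq, smul_eq_mul]
  gcongr ?_ * ?_
  exact setIntegral_mono_on h₁ h₂ hs h

theorem setAverage_ball_comp_isometry (T : F ≃ₗᵢ[ℝ] F) (g : F → ℝ) (r : ℝ) :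
    ⨍ h in ball (0 : F) r, g (T h) = ⨍ h in ball (0 : F) r, g h := by
  simp only [setAverage_eq]
  have h := T.measurePreserving.setIntegral_preimage_emb
    T.toHomeomorph.measurableEmbedding g (ball (0 : F) r)
  have h2 : T ⁻¹' ball (0 : F) r = ball 0 r := by ext x; simp
  rw [h2] at h
  rw [h]

theorem setAverage_inner (v : F) (r : ℝ) : ⨍ h in ball (0 : F) r, ⟪v, h⟫ = 0 := by
  have h := setAverage_ball_comp_isometry (LinearIsometryEquiv.neg ℝ) (fun h : F => ⟪v, h⟫) r
  have h2 : ⨍ h in ball (0 : F) r, ⟪v, -h⟫ = -⨍ h in ball (0 : F) r, ⟪v, h⟫ := by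
    simp [inner_neg_right]
  simp only [LinearIsometryEquiv.coe_neg] at h
  linarith

open scoped Pointwise in
theorem setAverage_normSq {r : ℝ} (hr : 0 < r) :
    ⨍ h in ball (0 : F) r, ‖h‖ ^ 2 = normSqMean F * r ^ 2 := by
  have h := Measure.setIntegral_comp_smul_of_pos volume (fun h : F => ‖h‖ ^ 2) (ball 0 1) hr
  have hb : r • ball (0 : F) 1 = ball 0 r := by
    rw [smul_unitBall_of_pos hr]
  rw [hb] at h
  simp only [normSqMean, setAverage_eq, smul_eq_mul, norm_smul, mul_pow] at h ⊢
  rw [integral_const_mul] at h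
  have hv : volume.real (ball (0 : F) r) =
      r ^ Module.finrank ℝ F * volume.real (ball (0 : F) 1) := by
    rw [Measure.real, Measure.addHaar_ball_of_pos volume _ hr, ENNReal.toReal_mul,
      ENNReal.toReal_ofReal (by positivity)]
    rfl
  have h1 := volume_real_ball_pos (0 : F) one_pos
  have hrd : 0 < r ^ Module.finrank ℝ F := by positivity
  have hI : ∫ h in ball (0 : F) r, ‖h‖ ^ 2
      = r ^ Module.finrank ℝ F * (r ^ 2 * ∫ h in ball (0 : F) 1, ‖h‖ ^ 2) := by
    rw [Real.norm_eq_abs, sq_abs] at h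
    rw [h]; field_simp
  rw [hv, hI]
  field_simp

theorem normSqMean_pos [Nontrivial F] : 0 < normSqMean F := by
  rw [normSqMean, setAverage_eq, smul_eq_mul]
  refine mul_pos (inv_pos.2 (volume_real_ball_pos _ one_pos)) ?_
  rw [setIntegral_pos_iff_support_of_nonneg_ae (.of_forall fun x => by positivity)
    (integrableOn_ball_of_continuousOn (by fun_prop))]
  have h0 : Function.support (fun h : F => ‖h‖ ^ 2) ∩ ball 0 1 = ball 0 1 \ {0} := by
    ext x; simp [and_comm]
  rw [h0, measure_sdiff_null (measure_singleton _)]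
  exact measure_ball_pos volume _ one_pos

theorem setAverage_inner_sq [Nontrivial F] (v : F) {r : ℝ} (hr : 0 < r) :
    ⨍ h in ball (0 : F) r, ⟪v, h⟫ ^ 2
      = ‖v‖ ^ 2 * (normSqMean F / Module.finrank ℝ F * r ^ 2) := by
  have hrot : ∀ u w : F, ‖u‖ = ‖w‖ →
      ⨍ h in ball (0 : F) r, ⟪u, h⟫ ^ 2 = ⨍ h in ball (0 : F) r, ⟪w, h⟫ ^ 2 := by
    intro u w huw
    rw [← setAverage_ball_comp_isometry ((ℝ ∙ (u - w))ᗮ.reflection) (fun h : F => ⟪w, h⟫ ^ 2)]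
    congr 1
    ext h
    have := ((ℝ ∙ (u - w))ᗮ.reflection).inner_map_map u h
    rw [Submodule.reflection_sub huw] at this
    rw [this]
  let b := stdOrthonormalBasis ℝ F
  have hd : 0 < Module.finrank ℝ F := Module.finrank_pos
  let i₀ : Fin (Module.finrank ℝ F) := ⟨0, hd⟩
  have hsum : ⨍ h in ball (0 : F) r, ‖h‖ ^ 2 = ∑ i, ⨍ h in ball (0 : F) r, ⟪b i, h⟫ ^ 2 := by
    simp only [setAverage_eq, smul_eq_mul]
    rw [← Finset.mul_sum, ← integral_finsetSum]
    · congr 2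
      ext h
      simpa using (b.sum_sq_norm_inner_right h).symm
    · intro i _
      exact integrableOn_ball_of_continuousOn (by fun_prop)
  have hunit : ∀ i, ⨍ h in ball (0 : F) r, ⟪b i, h⟫ ^ 2
      = normSqMean F / Module.finrank ℝ F * r ^ 2 := by
    intro i
    have h1 : ∀ j, ⨍ h in ball (0 : F) r, ⟪b j, h⟫ ^ 2 = ⨍ h in ball (0 : F) r, ⟪b i, h⟫ ^ 2 :=
      fun j => hrot _ _ (by simp)
    rw [setAverage_normSq hr, Finset.sum_congr rfl (fun j _ => h1 j)] at hsum
    simp only [Finset.sum_const, Finset.card_univ, Fintype.card_fin, nsmul_eq_mul] at hsum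
    have : (Module.finrank ℝ F : ℝ) ≠ 0 := by positivity
    field_simp
    linarith
  rw [hrot v (‖v‖ • b i₀) (by simp [norm_smul]), ← hunit i₀, ← setAverage_const_mul]
  congr 1
  ext h
  rw [real_inner_smul_left]; ring

theorem setAverage_inner_mul_inner [Nontrivial F] (u v : F) {r : ℝ} (hr : 0 < r) :
    ⨍ h in ball (0 : F) r, ⟪u, h⟫ * ⟪v, h⟫
      = ⟪u, v⟫ * (normSqMean F / Module.finrank ℝ F * r ^ 2) := by
  have h1 := setAverage_inner_sq (u + v) hr
  have h2 := setAverage_inner_sq (u - v) hr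
  have h3 : ⨍ h in ball (0 : F) r, ⟪u, h⟫ * ⟪v, h⟫
      = 1 / 4 * (⨍ h in ball (0 : F) r, ⟪u + v, h⟫ ^ 2)
        + (-1 / 4) * ⨍ h in ball (0 : F) r, ⟪u - v, h⟫ ^ 2 := by
    rw [← setAverage_const_mul, ← setAverage_const_mul, ← setAverage_add]
    · congr 1
      ext h
      rw [inner_add_left, inner_sub_left]; ring
    all_goals exact integrableOn_ball_of_continuousOn (by fun_prop)
  rw [h3, h1, h2, norm_add_sq_real, norm_sub_sq_real]
  ring

/-- Second-order binomial expansion of `(1 + t) ^ (-k)` at `t = 0`. -/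
theorem one_add_rpow_neg_isBigO (k : ℝ) :
    (fun t : ℝ => (1 + t) ^ (-k) - (1 - k * t + k * (k + 1) / 2 * t ^ 2))
      =O[𝓝 0] fun t => t ^ 3 := by
  have h := (Real.one_add_rpow_hasFPowerSeriesAt_zero (a := -k)).isBigO_sub_partialSum_pow 3
  have h2 : Ring.choose (-k) 2 = k * (k + 1) / 2 := by
    have h3 := Ring.descPochhammer_eq_factorial_smul_choose (-k) 2
    simp [descPochhammer, Polynomial.smeval_X, Polynomial.smeval_mul] at h3
    linarith
  refine (h.congr_left fun t => ?_).trans (.of_bound 1 (.of_forall fun t => by simp))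
  simp [FormalMultilinearSeries.partialSum, Finset.sum_range_succ, binomialSeries,
    FormalMultilinearSeries.coeff_ofScalars, h2]
  ring

/-- The Poisson kernel of the ball of radius `s` centered at the origin, with pole `p`,
normalized to take the value `1` at the origin. -/
def ballPoissonKernel (s : ℝ) (x p : F) : ℝ :=
  (s ^ 2 - ‖x‖ ^ 2) / s ^ 2 * (‖x - p‖ ^ 2 / s ^ 2) ^ (-((Module.finrank ℝ F : ℝ) / 2))

theorem ballPoissonKernel_expansion {F : Type*} [NormedAddCommGroup F] [InnerProductSpace ℝ F]
    {s : ℝ} {y : F} (hy : ‖y‖ < s) :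
    ∃ C : ℝ, ∀ᶠ h in 𝓝 (0 : F), ∀ p : F, ‖p‖ = s →
      |ballPoissonKernel s (y + h) p -
        (s ^ 2)⁻¹ * (‖y - p‖ ^ 2 / s ^ 2) ^ (-((Module.finrank ℝ F : ℝ) / 2)) *
        ((s ^ 2 - ‖y‖ ^ 2)
          + (-2 * ⟪y, h⟫ - Module.finrank ℝ F * (s ^ 2 - ‖y‖ ^ 2) / ‖y - p‖ ^ 2 * ⟪y - p, h⟫)
          + (-(Module.finrank ℝ F / 2 * (s ^ 2 - ‖y‖ ^ 2) / ‖y - p‖ ^ 2 + 1) * ‖h‖ ^ 2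
            + Module.finrank ℝ F * (Module.finrank ℝ F / 2 + 1) * (s ^ 2 - ‖y‖ ^ 2)
              / (‖y - p‖ ^ 2) ^ 2 * (⟪y - p, h⟫ * ⟪y - p, h⟫)
            + 2 * Module.finrank ℝ F / ‖y - p‖ ^ 2 * (⟪y, h⟫ * ⟪y - p, h⟫)))| ≤ C * ‖h‖ ^ 3 := by
  have hs : 0 < s := (norm_nonneg y).trans_lt hy
  obtain ⟨k, hk⟩ : ∃ k : ℝ, (Module.finrank ℝ F : ℝ) / 2 = k := ⟨_, rfl⟩
  have hk0 : 0 ≤ k := hk ▸ by positivity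
  have hd : (Module.finrank ℝ F : ℝ) = 2 * k := by linarith
  set N := s ^ 2 - ‖y‖ ^ 2 with hN
  let l : Filter (F × F) := 𝓝 0 ×ˢ 𝓟 (sphere (0 : F) s)
  let T : F × F → ℝ := fun z => ‖z.1‖
  let A : F × F → ℝ := fun z => ‖y - z.2‖ ^ 2
  let b : F × F → ℝ := fun z => ⟪y - z.2, z.1⟫
  let q : F × F → ℝ := fun z => ⟪y, z.1⟫
  let τ : F × F → ℝ := fun z => (2 * b z + T z ^ 2) * (A z)⁻¹
  let W : F × F → ℝ := fun z => (A z / s ^ 2) ^ (-k)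
  let R : F × F → ℝ := fun z => (1 + τ z) ^ (-k) - (1 - k * τ z + k * (k + 1) / 2 * τ z ^ 2)
  have hl : ∀ᶠ z in l, z.2 ∈ sphere (0 : F) s :=
    tendsto_snd.eventually (eventually_principal.2 fun _ h => h)
  have hfst : Tendsto (fun z : F × F => z.1) l (𝓝 0) := tendsto_fst
  have hTl : Tendsto T l (𝓝 0) := by simpa using hfst.norm
  have hAle : ∀ z : F × F, z.2 ∈ sphere (0 : F) s → s - ‖y‖ ≤ ‖y - z.2‖ := by
    intro z hz
    have := norm_sub_norm_le z.2 y
    rw [mem_sphere_zero_iff_norm.1 hz, norm_sub_rev] at this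
    exact this
  have hA0 : ∀ z : F × F, z.2 ∈ sphere (0 : F) s → 0 < A z := fun z hz => by
    have := hAle z hz
    have : 0 < ‖y - z.2‖ := by linarith
    positivity
  have hT1 : T =O[l] (fun _ => (1 : ℝ)) := hTl.isBigO_one ℝ
  have hAinv : (fun z => (A z)⁻¹) =O[l] (fun _ => (1 : ℝ)) := by
    refine .of_bound (((s - ‖y‖) ^ 2)⁻¹) (hl.mono fun z hz => ?_)
    have := hAle z hz
    rw [norm_one, mul_one, Real.norm_of_nonneg (inv_nonneg.2 (hA0 z hz).le)]
    have : 0 < s - ‖y‖ := by linarith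
    simp only [A]
    gcongr
  have hW : W =O[l] (fun _ => (1 : ℝ)) := by
    refine .of_bound (((s - ‖y‖) ^ 2 / s ^ 2) ^ (-k)) (hl.mono fun z hz => ?_)
    have := hAle z hz
    have h0 : 0 < s - ‖y‖ := by linarith
    have hA0 := hA0 z hz
    rw [norm_one, mul_one, Real.norm_of_nonneg (by positivity)]
    refine Real.rpow_le_rpow_of_nonpos (by positivity) ?_ (by linarith)
    simp only [A]
    gcongr
  have hb : b =O[l] T := by
    refine .of_bound (‖y‖ + s) (hl.mono fun z hz => ?_)
    refine (norm_inner_le_norm _ _).trans ?_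
    simp only [T, norm_norm]
    gcongr
    exact (norm_sub_le _ _).trans (by rw [mem_sphere_zero_iff_norm.1 hz])
  have hq : q =O[l] T := by
    refine .of_bound ‖y‖ (.of_forall fun z => ?_)
    have := norm_inner_le_norm (𝕜 := ℝ) y z.1
    simpa only [T, q, norm_norm] using this
  have hc : ∀ c : ℝ, (fun _ : F × F => c) =O[l] (fun _ => (1 : ℝ)) :=
    fun c => Asymptotics.isBigO_const_const c one_ne_zero l
  have hTT : (fun z => T z ^ 2) =O[l] T := by
    simpa [sq] using (Asymptotics.isBigO_refl T l).mul hT1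
  have hτ : τ =O[l] T := by
    simpa using (((hb.const_mul_left 2).add hTT).mul hAinv)
  have hR : R =O[l] fun z => T z ^ 3 :=
    ((one_add_rpow_neg_isBigO k).comp_tendsto (hτ.trans_tendsto hTl)).trans (hτ.pow 3)
  have hn := Asymptotics.isBigO_refl (fun z => T z ^ 2) l
  have hT := Asymptotics.isBigO_refl T l
  have key : (fun z => W z * (
      (N * (k * (k + 1) / 2)) * ((4 * b z + T z ^ 2) * T z ^ 2 * ((A z)⁻¹ * (A z)⁻¹))
      + (2 * k) * (q z * T z ^ 2 * (A z)⁻¹)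
      - (k * (k + 1)) * (q z * (τ z * τ z))
      + k * (T z ^ 2 * τ z) - (k * (k + 1) / 2) * (T z ^ 2 * τ z * τ z)
      + (N - 2 * q z - T z ^ 2) * R z)) =O[l] fun z => T z ^ 3 := by
    have e1 : (fun z => (4 * b z + T z ^ 2) * T z ^ 2 * ((A z)⁻¹ * (A z)⁻¹)) =O[l]
        fun z => T z ^ 3 := by
      refine ((((hb.const_mul_left 4).add hTT).mul hn).mul (hAinv.mul hAinv)).congr_right ?_
      intro z; ring
    have e2 : (fun z => q z * T z ^ 2 * (A z)⁻¹) =O[l] fun z => T z ^ 3 :=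
      ((hq.mul hn).mul hAinv).congr_right fun z => by ring
    have e3 : (fun z => q z * (τ z * τ z)) =O[l] fun z => T z ^ 3 :=
      (hq.mul (hτ.mul hτ)).congr_right fun z => by ring
    have e4 : (fun z => T z ^ 2 * τ z) =O[l] fun z => T z ^ 3 :=
      (hn.mul hτ).congr_right fun z => by ring
    have e5 : (fun z => T z ^ 2 * τ z * τ z) =O[l] fun z => T z ^ 3 :=
      (e4.mul (hτ.trans hT1)).congr_right fun z => by ring
    have e6 : (fun z => (N - 2 * q z - T z ^ 2) * R z) =O[l] fun z => T z ^ 3 :=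
      ((((hc N).sub ((hq.trans hT1).const_mul_left 2)).sub (hTT.trans hT1)).mul hR).congr_right
        fun z => by ring
    refine (hW.mul ((((((e1.const_mul_left _).add (e2.const_mul_left _)).sub
      (e3.const_mul_left _)).add (e4.const_mul_left _)).sub (e5.const_mul_left _)).add
      e6)).congr_right fun z => by ring
  obtain ⟨C, hC⟩ := (key.const_mul_left (s ^ 2)⁻¹).bound
  refine ⟨C, ?_⟩
  rw [eventually_prod_principal_iff] at hC
  filter_upwards [hC] with h hh p hp
  have hps : p ∈ sphere (0 : F) s := mem_sphere_zero_iff_norm.2 hp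
  have h1 := hh p hps
  have hAp := hA0 (h, p) hps
  have hexp : ‖y + h - p‖ ^ 2 = A (h, p) * (1 + τ (h, p)) := by
    have : y + h - p = (y - p) + h := by abel
    rw [this, norm_add_sq_real]
    simp only [τ]
    rw [mul_add, mul_one, mul_left_comm]
    rw [mul_inv_cancel₀ hAp.ne', mul_one]
    simp only [A, b, T]
    ring
  have hτ0 : 0 ≤ 1 + τ (h, p) := by
    by_contra hneg
    have := mul_neg_of_pos_of_neg hAp (not_le.1 hneg)
    rw [← hexp] at this
    exact absurd this (not_lt.2 (by positivity))
  have hrpow : (‖y + h - p‖ ^ 2 / s ^ 2) ^ (-k) = W (h, p) * (1 + τ (h, p)) ^ (-k) := by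
    rw [hexp, mul_div_right_comm, Real.mul_rpow (by positivity) hτ0]
  rw [norm_pow, Real.norm_of_nonneg (norm_nonneg h : 0 ≤ T (h, p))] at h1
  refine le_trans (le_of_eq ?_) h1
  rw [Real.norm_eq_abs, ballPoissonKernel, hk, hrpow, hd]
  congr 1
  have hRe : (1 + τ (h, p)) ^ (-k) = R (h, p) +
      (1 - k * τ (h, p) + k * (k + 1) / 2 * τ (h, p) ^ 2) := by simp only [R]; ring
  have hnorm : s ^ 2 - ‖y + h‖ ^ 2 = N - 2 * q (h, p) - T (h, p) ^ 2 := by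
    rw [norm_add_sq_real, hN]; simp only [q, T]; ring
  rw [hRe, hnorm]
  have hWp : (‖y - p‖ ^ 2 / s ^ 2) ^ (-k) = W (h, p) := rfl
  have hbp : ⟪y - p, h⟫ = b (h, p) := rfl
  have hqp : ⟪y, h⟫ = q (h, p) := rfl
  have hTp : ‖h‖ = T (h, p) := rfl
  have hAe : ‖y - p‖ ^ 2 = A (h, p) := rfl
  have hτe : τ (h, p) = (2 * b (h, p) + T (h, p) ^ 2) * (A (h, p))⁻¹ := rfl
  rw [hWp, hbp, hqp, hTp, hAe, hτe]
  have ha := hAp.ne'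
  generalize R (h, p) = r, W (h, p) = w, b (h, p) = b', q (h, p) = q', T (h, p) = t,
    A (h, p) = a at *
  field_simp
  ring

theorem continuousOn_ballPoissonKernel {F : Type*} [NormedAddCommGroup F] [InnerProductSpace ℝ F]
    (s : ℝ) :
    ContinuousOn (fun z : F × F => ballPoissonKernel s z.1 z.2) (ball 0 s ×ˢ sphere 0 s) := by
  unfold ballPoissonKernel
  refine ContinuousOn.mul (by fun_prop) (ContinuousOn.rpow_const (by fun_prop) ?_)
  rintro ⟨x, p⟩ ⟨hx, hp⟩
  rw [mem_ball_zero_iff] at hx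
  rw [mem_sphere_zero_iff_norm] at hp
  simp only at hx hp
  have hs : 0 < s := (norm_nonneg x).trans_lt hx
  have : 0 < ‖x - p‖ := norm_pos_iff.2 fun h => by
    rw [sub_eq_zero.1 h, hp] at hx
    exact hx.false
  left
  simp only
  positivity

theorem setAverage_second_order [Nontrivial F] (y v : F) (c n α β e f g : ℝ) {r : ℝ}
    (hr : 0 < r) :
    ⨍ h in ball (0 : F) r, c * (n + (α * ⟪y, h⟫ - β * ⟪v, h⟫)
      + (e * ‖h‖ ^ 2 + f * (⟪v, h⟫ * ⟪v, h⟫) + g * (⟪y, h⟫ * ⟪v, h⟫)))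
    = c * (n + (e + (f * ‖v‖ ^ 2 + g * ⟪y, v⟫) / Module.finrank ℝ F) * (normSqMean F * r ^ 2)) := by
  have hi : ∀ {g : F → ℝ}, Continuous g → IntegrableOn g (ball (0 : F) r) :=
    fun hg => integrableOn_ball_of_continuousOn hg.continuousOn
  rw [setAverage_const_mul]
  simp only [sub_eq_add_neg, ← neg_mul]
  rw [setAverage_add (hi (by fun_prop)) (hi (by fun_prop)),
    setAverage_add (hi (by fun_prop)) (hi (by fun_prop)),
    setAverage_add (hi (by fun_prop)) (hi (by fun_prop)),
    setAverage_add (hi (by fun_prop)) (hi (by fun_prop)),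
    setAverage_add (hi (by fun_prop)) (hi (by fun_prop))]
  simp only [setAverage_const_mul, setAverage_inner, setAverage_ball_const hr,
    setAverage_normSq hr, setAverage_inner_mul_inner _ _ hr, real_inner_self_eq_norm_sq]
  ring

theorem abs_setAverage_ball_sub_le {g₁ g₂ : F → ℝ} {r c : ℝ} (hr : 0 < r)
    (h₁ : IntegrableOn g₁ (ball (0 : F) r)) (h₂ : IntegrableOn g₂ (ball (0 : F) r))
    (h : ∀ x ∈ ball (0 : F) r, |g₁ x - g₂ x| ≤ c) :
    |(⨍ h in ball (0 : F) r, g₁ h) - ⨍ h in ball (0 : F) r, g₂ h| ≤ c := by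
  have hc : IntegrableOn (fun _ => c) (ball (0 : F) r) :=
    integrableOn_ball_of_continuousOn continuousOn_const
  have e₁ := setAverage_mono measurableSet_ball h₁ (h₂.add hc)
    fun x hx => by have := (abs_le.1 (h x hx)).2; simp only [Pi.add_apply]; linarith
  have e₂ := setAverage_mono measurableSet_ball h₂ (h₁.add hc)
    fun x hx => by have := (abs_le.1 (h x hx)).1; simp only [Pi.add_apply]; linarith
  simp only [Pi.add_apply] at e₁ e₂
  rw [setAverage_add h₂ hc, setAverage_ball_const hr] at e₁
  rw [setAverage_add h₁ hc, setAverage_ball_const hr] at e₂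
  rw [abs_le]
  constructor <;> linarith

theorem ballMean_ballPoissonKernel [Nontrivial F] {s : ℝ} {y : F} (hy : ‖y‖ < s) :
    ∃ C : ℝ, ∀ᶠ r in 𝓝[>] (0 : ℝ), ∀ p : F, ‖p‖ = s →
      |ballMean (fun x => ballPoissonKernel s x p) y r - ballPoissonKernel s y p|
        ≤ C * r ^ 3 := by
  obtain ⟨C, hC⟩ := ballPoissonKernel_expansion hy
  obtain ⟨δ, hδ, hC⟩ := Metric.eventually_nhds_iff_ball.1 hC
  refine ⟨|C|, ?_⟩
  filter_upwards [Ioo_mem_nhdsGT (lt_min hδ (sub_pos.2 hy))] with r ⟨hr, hr'⟩ p hp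
  rw [lt_min_iff] at hr'
  have hd : (Module.finrank ℝ F : ℝ) ≠ 0 := by
    exact_mod_cast Module.finrank_pos.ne'
  have hyp : 0 < ‖y - p‖ := norm_pos_iff.2 fun h => by
    rw [sub_eq_zero.1 h, hp] at hy
    exact hy.false
  have hsub : closedBall y r ⊆ ball 0 s := by
    refine closedBall_subset_ball' ?_
    rw [dist_zero_right]
    linarith [hr'.2]
  have hcont : ContinuousOn (fun x => ballPoissonKernel s x p) (closedBall y r) :=
    (continuousOn_ballPoissonKernel s).comp (f := fun x => (x, p)) (by fun_prop)
      fun x hx => ⟨hsub hx, mem_sphere_zero_iff_norm.2 hp⟩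
  have key := setAverage_second_order y (y - p)
    ((s ^ 2)⁻¹ * (‖y - p‖ ^ 2 / s ^ 2) ^ (-((Module.finrank ℝ F : ℝ) / 2))) (s ^ 2 - ‖y‖ ^ 2)
    (-2) (Module.finrank ℝ F * (s ^ 2 - ‖y‖ ^ 2) / ‖y - p‖ ^ 2)
    (-(Module.finrank ℝ F / 2 * (s ^ 2 - ‖y‖ ^ 2) / ‖y - p‖ ^ 2 + 1))
    (Module.finrank ℝ F * (Module.finrank ℝ F / 2 + 1) * (s ^ 2 - ‖y‖ ^ 2)
              / (‖y - p‖ ^ 2) ^ 2) (2 * Module.finrank ℝ F / ‖y - p‖ ^ 2) hr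
  have hcoef : (-(Module.finrank ℝ F / 2 * (s ^ 2 - ‖y‖ ^ 2) / ‖y - p‖ ^ 2 + 1)) +
      ((Module.finrank ℝ F * (Module.finrank ℝ F / 2 + 1) * (s ^ 2 - ‖y‖ ^ 2)
              / (‖y - p‖ ^ 2) ^ 2) * ‖y - p‖ ^ 2
        + (2 * Module.finrank ℝ F / ‖y - p‖ ^ 2) * ⟪y, y - p⟫) / Module.finrank ℝ F = 0 := by
    have e1 : ⟪y, y - p⟫ = ‖y‖ ^ 2 - ⟪y, p⟫ := by
      rw [inner_sub_right, real_inner_self_eq_norm_sq]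
    have e2 : ‖y - p‖ ^ 2 = ‖y‖ ^ 2 - 2 * ⟪y, p⟫ + s ^ 2 := by rw [norm_sub_sq_real, hp]
    have e3 : ⟪y, y - p⟫ = (‖y - p‖ ^ 2 + ‖y‖ ^ 2 - s ^ 2) / 2 := by rw [e1, e2]; ring
    rw [e3]
    field_simp
    ring
  rw [hcoef, zero_mul, add_zero] at key
  have hKy : (s ^ 2)⁻¹ * (‖y - p‖ ^ 2 / s ^ 2) ^ (-((Module.finrank ℝ F : ℝ) / 2))
      * (s ^ 2 - ‖y‖ ^ 2) = ballPoissonKernel s y p := by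
    rw [ballPoissonKernel]; ring
  rw [hKy] at key
  rw [← key]
  refine abs_setAverage_ball_sub_le hr (integrableOn_ball_comp_add hcont)
    (integrableOn_ball_of_continuousOn (by fun_prop)) fun h hh => ?_
  refine (hC h (ball_subset_ball hr'.1.le hh) p hp).trans ?_
  rw [mem_ball_zero_iff] at hh
  have := le_abs_self C
  gcongr

/-- The normalized surface measure of the unit sphere. -/
def sphereProb (F : Type*) [NormedAddCommGroup F] [InnerProductSpace ℝ F] [FiniteDimensional ℝ F]
    [MeasurableSpace F] [BorelSpace F] : Measure (sphere (0 : F) 1) :=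
  ((volume : Measure F).toSphere univ)⁻¹ • (volume : Measure F).toSphere

instance [Nontrivial F] : IsProbabilityMeasure (sphereProb F) := by
  have h0 : (volume : Measure F).toSphere univ ≠ 0 :=
    Measure.measure_univ_ne_zero.2 (Measure.toSphere_ne_zero _)
  exact ⟨by rw [sphereProb, Measure.smul_apply, smul_eq_mul,
    ENNReal.inv_mul_cancel h0 (measure_ne_top _ _)]⟩

/-- The Poisson integral of `f` over the sphere of radius `s` centered at the origin. -/
def poissonInt (s : ℝ) (f : F → ℝ) (x : F) : ℝ :=
  ∫ ζ, ballPoissonKernel s x (s • (ζ : F)) * f (s • (ζ : F)) ∂sphereProb F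

theorem norm_smul_sphere {F : Type*} [NormedAddCommGroup F] [InnerProductSpace ℝ F]
    {s : ℝ} (hs : 0 ≤ s) (ζ : sphere (0 : F) 1) : ‖s • (ζ : F)‖ = s := by
  rw [norm_smul, mem_sphere_zero_iff_norm.1 ζ.2, mul_one, Real.norm_of_nonneg hs]

theorem continuousOn_poissonInt_integrand {F : Type*} [NormedAddCommGroup F]
    [InnerProductSpace ℝ F] {s : ℝ} (hs : 0 ≤ s) {f : F → ℝ} (hf : Continuous f) :
    ContinuousOn (fun z : F × sphere (0 : F) 1 =>
      ballPoissonKernel s z.1 (s • (z.2 : F)) * f (s • (z.2 : F))) (ball 0 s ×ˢ univ) := by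
  refine ContinuousOn.mul ?_ (by fun_prop)
  exact (continuousOn_ballPoissonKernel s).comp
    (f := fun z : F × sphere (0 : F) 1 => (z.1, s • (z.2 : F))) (by fun_prop)
    fun z hz => ⟨hz.1, mem_sphere_zero_iff_norm.2 (norm_smul_sphere hs _)⟩

theorem continuousOn_poissonInt [Nontrivial F] {s : ℝ} (hs : 0 ≤ s) {f : F → ℝ}
    (hf : Continuous f) : ContinuousOn (poissonInt s f) (ball 0 s) :=
  continuousOn_integral_of_compact_support isCompact_univ
    (continuousOn_poissonInt_integrand hs hf) fun _ _ _ h => (h (mem_univ _)).elim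

theorem continuous_ballPoissonKernel_sphere {F : Type*} [NormedAddCommGroup F]
    [InnerProductSpace ℝ F] {s : ℝ} {x : F} (hx : ‖x‖ < s) :
    Continuous (fun ζ : sphere (0 : F) 1 => ballPoissonKernel s x (s • (ζ : F))) := by
  rw [← continuousOn_univ]
  exact (continuousOn_ballPoissonKernel s).comp
    (f := fun ζ : sphere (0 : F) 1 => (x, s • (ζ : F))) (by fun_prop)
    fun z hz => ⟨mem_ball_zero_iff.2 hx,
      mem_sphere_zero_iff_norm.2 (norm_smul_sphere ((norm_nonneg x).trans hx.le) _)⟩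

theorem integrable_sphereProb [Nontrivial F] {g : sphere (0 : F) 1 → ℝ} (hg : Continuous g) :
    Integrable g (sphereProb F) :=
  hg.integrable_of_hasCompactSupport (HasCompactSupport.of_compactSpace g)

theorem integrable_poissonInt_integrand [Nontrivial F] {s r : ℝ} (hs : 0 ≤ s) {f : F → ℝ}
    (hf : Continuous f) {y : F} (hyr : closedBall y r ⊆ ball 0 s) :
    Integrable (Function.uncurry fun (h : F) (ζ : sphere (0 : F) 1) =>
      ballPoissonKernel s (y + h) (s • (ζ : F)) * f (s • (ζ : F)))
      ((volume.restrict (ball (0 : F) r)).prod (sphereProb F)) := by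
  have hcont : ContinuousOn (fun z : F × sphere (0 : F) 1 =>
      ballPoissonKernel s (y + z.1) (s • (z.2 : F)) * f (s • (z.2 : F)))
      (closedBall 0 r ×ˢ univ) :=
    (continuousOn_poissonInt_integrand hs hf).comp
      (f := fun z : F × sphere (0 : F) 1 => (y + z.1, z.2)) (by fun_prop)
      fun z hz => ⟨hyr (by simpa using hz.1), mem_univ _⟩
  have h1 := hcont.integrableOn_compact (μ := (volume : Measure F).prod (sphereProb F))
    ((isCompact_closedBall 0 r).prod isCompact_univ)
  have h2 := h1.mono_set (prod_mono (ball_subset_closedBall (x := (0 : F)) (ε := r))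
    (subset_refl univ))
  rw [IntegrableOn, ← Measure.prod_restrict, Measure.restrict_univ] at h2
  exact h2

theorem ballMean_poissonInt_eq [Nontrivial F] {s r : ℝ} (hs : 0 ≤ s) {f : F → ℝ}
    (hf : Continuous f) {y : F} (hyr : closedBall y r ⊆ ball 0 s) :
    ballMean (poissonInt s f) y r =
      ∫ ζ, ballMean (fun x => ballPoissonKernel s x (s • (ζ : F))) y r * f (s • (ζ : F))
        ∂sphereProb F := by
  simp only [ballMean, setAverage_eq, poissonInt, smul_eq_mul]
  rw [integral_integral_swap (integrable_poissonInt_integrand hs hf hyr), ← integral_const_mul]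
  simp only [integral_mul_const, mul_assoc]

theorem ballMean_poissonInt [Nontrivial F] {s : ℝ} {f : F → ℝ} (hf : Continuous f) {y : F}
    (hy : ‖y‖ < s) :
    ∃ C : ℝ, ∀ᶠ r in 𝓝[>] (0 : ℝ),
      |ballMean (poissonInt s f) y r - poissonInt s f y| ≤ C * r ^ 3 := by
  have hs : 0 ≤ s := (norm_nonneg y).trans hy.le
  obtain ⟨C, hC⟩ := ballMean_ballPoissonKernel hy
  obtain ⟨M, hM⟩ := (isCompact_closedBall (0 : F) s).exists_bound_of_continuousOn hf.continuousOn
  refine ⟨|C| * M, ?_⟩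
  filter_upwards [hC, Ioo_mem_nhdsGT (sub_pos.2 hy)] with r h ⟨hr, hr'⟩
  have hsub : closedBall y r ⊆ ball 0 s := by
    refine closedBall_subset_ball' ?_
    rw [dist_zero_right]
    linarith
  have hbound : ∀ ζ : sphere (0 : F) 1,
      ‖(ballMean (fun x => ballPoissonKernel s x (s • (ζ : F))) y r
        - ballPoissonKernel s y (s • (ζ : F))) * f (s • (ζ : F))‖ ≤ |C| * M * r ^ 3 := fun ζ => by
    have h1 := h (s • (ζ : F)) (norm_smul_sphere hs ζ)
    have h2 := hM (s • (ζ : F)) (mem_closedBall_zero_iff.2 (norm_smul_sphere hs ζ).le)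
    have h3 := le_abs_self C
    have h4 : |ballMean (fun x => ballPoissonKernel s x (s • (ζ : F))) y r
        - ballPoissonKernel s y (s • (ζ : F))| ≤ |C| * r ^ 3 := h1.trans (by gcongr)
    calc _ ≤ (|C| * r ^ 3) * M := by
          rw [norm_mul, Real.norm_eq_abs]
          exact mul_le_mul h4 h2 (norm_nonneg _) (by positivity)
      _ = _ := by ring
  have hi1 : Integrable (fun ζ : sphere (0 : F) 1 =>
      ballPoissonKernel s y (s • (ζ : F)) * f (s • (ζ : F))) (sphereProb F) :=
    integrable_sphereProb ((continuous_ballPoissonKernel_sphere hy).mul (by fun_prop))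
  have hi2 : Integrable (fun ζ : sphere (0 : F) 1 =>
      ballMean (fun x => ballPoissonKernel s x (s • (ζ : F))) y r * f (s • (ζ : F)))
      (sphereProb F) := by
    have h1 := (integrable_poissonInt_integrand hs hf hsub).swap.integral_prod_left.const_mul
      (volume.real (ball (0 : F) r))⁻¹
    simp only [Function.comp_apply, Prod.swap, Function.uncurry_apply_pair, integral_mul_const,
      ← mul_assoc] at h1
    simpa only [ballMean, setAverage_eq, smul_eq_mul] using h1
  rw [ballMean_poissonInt_eq hs hf hsub, poissonInt, ← integral_sub hi2 hi1]
  simp only [← sub_mul]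
  simpa using norm_integral_le_of_norm_le_const (μ := sphereProb F) (.of_forall hbound)

theorem erealToENNReal_eq (x : EReal) : erealToENNReal x = x.toENNReal := rfl

theorem erealBallAvg_mono {u v : F → EReal} {x : F} {r : ℝ} (h : ∀ y ∈ ball x r, u y ≤ v y) :
    erealBallAvg u x r ≤ erealBallAvg v x r := by
  simp only [erealBallAvg, erealToENNReal_eq]
  refine EReal.sub_le_sub ?_ ?_ <;> rw [EReal.coe_ennreal_le_coe_ennreal_iff] <;>
    refine ENNReal.div_le_div_right (setLIntegral_mono' measurableSet_ball fun y hy => ?_) _ <;>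
    refine EReal.toENNReal_le_toENNReal ?_
  · exact h y hy
  · exact EReal.neg_le_neg_iff.2 (h y hy)

theorem ballMean_eq (g : F → ℝ) (y : F) (r : ℝ) : ballMean g y r = ⨍ z in ball y r, g z := by
  have h := (measurePreserving_add_left (volume : Measure F) y).setIntegral_preimage_emb
    (measurableEmbedding_addLeft y) g (ball y r)
  have h2 : (fun x => y + x) ⁻¹' ball y r = ball 0 r := by ext x; simp
  rw [h2] at h
  rw [ballMean, setAverage_eq, setAverage_eq, h, Measure.real, Measure.real,
    Measure.addHaar_ball_center volume y]

theorem erealBallAvg_coe {g : F → ℝ} {y : F} {r : ℝ} (hr : 0 < r)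
    (hg : IntegrableOn g (ball y r)) :
    erealBallAvg (fun z => (g z : EReal)) y r = ballMean g y r := by
  have hv : volume (ball y r) ≠ 0 := (measure_ball_pos volume y hr).ne'
  have h1 : ∫⁻ z in ball y r, ENNReal.ofReal (g z) ≠ ⊤ := hg.lintegral_lt_top.ne
  have h2 : ∫⁻ z in ball y r, ENNReal.ofReal (-g z) ≠ ⊤ := hg.neg.lintegral_lt_top.ne
  rw [ballMean_eq, setAverage_eq, integral_eq_lintegral_pos_part_sub_lintegral_neg_part hg]
  simp only [erealBallAvg, erealToENNReal_eq, ← EReal.coe_neg, EReal.real_coe_toENNReal]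
  rw [← EReal.coe_ennreal_toReal (ENNReal.div_ne_top h1 hv),
    ← EReal.coe_ennreal_toReal (ENNReal.div_ne_top h2 hv), ← EReal.coe_sub]
  congr 1
  rw [ENNReal.toReal_div, ENNReal.toReal_div, Measure.real, smul_eq_mul]
  ring

/-- A function that touches a continuous comparison function from below at no interior point
is controlled by its boundary values. -/
theorem le_add_of_boundary_le {φ : F → EReal} {G : F → ℝ} {r ε : ℝ}
    (hφ : UpperSemicontinuousOn φ (closedBall 0 r)) (hG : ContinuousOn G (closedBall 0 r))
    (htop : ∀ y ∈ closedBall (0 : F) r, φ y ≠ ⊤)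
    (hbdry : ∀ y ∈ sphere (0 : F) r, φ y ≤ ((G y + ε : ℝ) : EReal))
    (hint : ∀ y ∈ ball (0 : F) r, ∀ c : ℝ, φ y = c →
      ∃ᶠ ρ in 𝓝[>] (0 : ℝ), ((c + (ballMean G y ρ - G y) : ℝ) : EReal) < erealBallAvg φ y ρ) :
    ∀ y ∈ closedBall (0 : F) r, φ y ≤ ((G y + ε : ℝ) : EReal) := by
  intro y hy
  have hH : UpperSemicontinuousOn (fun z => φ z + ((-G z : ℝ) : EReal)) (closedBall 0 r) := by
    refine hφ.add' (ContinuousOn.upperSemicontinuousOn ?_) fun z hz =>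
      EReal.continuousAt_add (Or.inr (EReal.coe_ne_bot _)) (Or.inr (EReal.coe_ne_top _))
    exact continuous_coe_real_ereal.comp_continuousOn hG.neg
  obtain ⟨y₀, hy₀, hmax⟩ := hH.exists_isMaxOn ⟨y, hy⟩ (isCompact_closedBall 0 r)
  have hle : ∀ z ∈ closedBall (0 : F) r, ∀ c : ℝ, φ y₀ ≤ c →
      φ z ≤ ((G z + (c - G y₀) : ℝ) : EReal) := by
    intro z hz c hc
    have h1 : φ z + ((-G z : ℝ) : EReal) ≤ ((c - G y₀ : ℝ) : EReal) := by
      refine (hmax hz).trans ((add_le_add_left hc _).trans_eq ?_)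
      rw [← EReal.coe_add, sub_eq_add_neg]
    have h3 := htop z hz
    induction h : φ z with
    | bot => simp
    | top => exact (h3 h).elim
    | coe a =>
      rw [h] at h1
      norm_cast at h1 ⊢
      linarith
  by_cases hcase : φ y₀ ≤ ((G y₀ + ε : ℝ) : EReal)
  · simpa using hle y hy _ hcase
  have hball : y₀ ∈ ball (0 : F) r := by
    rw [mem_ball]
    refine lt_of_le_of_ne hy₀ fun h => hcase (hbdry y₀ h)
  obtain ⟨c, hc⟩ : ∃ c : ℝ, φ y₀ = c := by
    have h3 := htop y₀ hy₀
    induction h : φ y₀ with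
    | bot => exact (hcase (by simp [h])).elim
    | top => exact (h3 h).elim
    | coe a => exact ⟨a, rfl⟩
  have hev : ∀ᶠ ρ in 𝓝[>] (0 : ℝ),
      erealBallAvg φ y₀ ρ ≤ ((c + (ballMean G y₀ ρ - G y₀) : ℝ) : EReal) := by
    rw [mem_ball_zero_iff] at hball
    filter_upwards [Ioo_mem_nhdsGT (sub_pos.2 hball)] with ρ ⟨hρ, hρ'⟩
    have hsub : closedBall y₀ ρ ⊆ closedBall 0 r := by
      refine closedBall_subset_closedBall' ?_
      rw [dist_zero_right]
      linarith
    have hGi := hG.mono hsub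
    refine (erealBallAvg_mono fun z hz =>
      hle z (hsub (ball_subset_closedBall hz)) c hc.le).trans_eq ?_
    have hi : ContinuousOn (fun z => G z + (c - G y₀)) (closedBall y₀ ρ) :=
      hGi.add continuousOn_const
    rw [erealBallAvg_coe hρ (integrableOn_ball_of_continuousOn hi),
      ballMean, setAverage_add (integrableOn_ball_comp_add hGi)
        (integrableOn_ball_of_continuousOn continuousOn_const), setAverage_ball_const hρ, ballMean]
    congr 1
    ring
  exact ((hint y₀ hball c hc).and_eventually hev).exists.elim
    fun ρ hρ => (hρ.1.not_ge hρ.2).elim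

theorem eventually_mul_pow_three_lt (C : ℝ) {a : ℝ} (ha : 0 < a) :
    ∀ᶠ r in 𝓝[>] (0 : ℝ), C * r ^ 3 < a * r ^ 2 := by
  have h : Tendsto (fun r : ℝ => C * r) (𝓝[>] 0) (𝓝 0) := by
    have : Continuous fun r : ℝ => C * r := by fun_prop
    simpa using (this.tendsto 0).mono_left nhdsWithin_le_nhds
  filter_upwards [h.eventually_lt_const ha, self_mem_nhdsWithin] with r hr hr0
  have : 0 < r ^ 2 := pow_pos hr0 2
  nlinarith

theorem ballMean_add_normSq {G : F → ℝ} {y : F} {r : ℝ} (hr : 0 < r)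
    (hG : ContinuousOn G (closedBall y r)) (c : ℝ) :
    ballMean (fun x => G x + c * ‖x‖ ^ 2) y r
      = ballMean G y r + c * (‖y‖ ^ 2 + normSqMean F * r ^ 2) := by
  have hi : ∀ {g : F → ℝ}, Continuous g → IntegrableOn g (ball (0 : F) r) :=
    fun hg => integrableOn_ball_of_continuousOn hg.continuousOn
  rw [ballMean, setAverage_add (integrableOn_ball_comp_add hG) (hi (by fun_prop)),
    setAverage_const_mul, ballMean]
  simp only [norm_add_sq_real]
  rw [setAverage_add (hi (by fun_prop)) (hi (by fun_prop)),
    setAverage_add (hi (by fun_prop)) (hi (by fun_prop)), setAverage_ball_const hr,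
    setAverage_const_mul, setAverage_inner, setAverage_normSq hr]
  ring

open scoped Pointwise in
theorem measurePreserving_sphereProb (T : F ≃ₗᵢ[ℝ] F) :
    MeasurePreserving (fun ζ : sphere (0 : F) 1 =>
      (⟨T ζ, by simp [T.norm_map]⟩ : sphere (0 : F) 1)) (sphereProb F) (sphereProb F) := by
  have hm : Measurable (fun ζ : sphere (0 : F) 1 =>
      (⟨T ζ, by simp [T.norm_map]⟩ : sphere (0 : F) 1)) :=
    (Continuous.subtype_mk (by fun_prop) _).measurable
  refine ⟨hm, ?_⟩
  ext A hA
  rw [Measure.map_apply hm hA, sphereProb, Measure.smul_apply, Measure.smul_apply,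
    Measure.toSphere_apply' _ hA, Measure.toSphere_apply' _ (hm hA)]
  congr 2
  have hset : Ioo (0 : ℝ) 1 • ((↑) '' ((fun ζ : sphere (0 : F) 1 =>
      (⟨T ζ, by simp [T.norm_map]⟩ : sphere (0 : F) 1)) ⁻¹' A) : Set F)
      = T ⁻¹' (Ioo (0 : ℝ) 1 • ((↑) '' A : Set F)) := by
    ext x
    simp only [Set.mem_smul, mem_preimage]
    constructor
    · rintro ⟨t, ht, _, ⟨ζ, hζ, rfl⟩, rfl⟩
      exact ⟨t, ht, _, ⟨_, hζ, rfl⟩, (map_smul T t _).symm⟩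
    · rintro ⟨t, ht, _, ⟨ζ, hζ, rfl⟩, hx⟩
      refine ⟨t, ht, T.symm ζ, ⟨⟨T.symm ζ, by simp [T.symm.norm_map]⟩, ?_, rfl⟩, ?_⟩
      · simpa using hζ
      · apply T.injective
        rw [map_smul, T.apply_symm_apply]
        exact hx
  rw [hset, T.measurePreserving.measure_preimage_emb T.toHomeomorph.measurableEmbedding]

theorem integral_sphereProb_comp_isometry (T : F ≃ₗᵢ[ℝ] F) {g : sphere (0 : F) 1 → ℝ}
    (hg : Continuous g) :
    ∫ ζ : sphere (0 : F) 1, g ⟨T ζ, by simp [T.norm_map]⟩ ∂sphereProb F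
      = ∫ ζ, g ζ ∂sphereProb F := by
  have hm := measurePreserving_sphereProb T
  conv_rhs => rw [← hm.map_eq]
  rw [integral_map hm.measurable.aemeasurable hg.aestronglyMeasurable]

theorem poissonInt_one_isometry (T : F ≃ₗᵢ[ℝ] F) {s : ℝ} {x : F} (hx : ‖x‖ < s) :
    poissonInt s (fun _ => 1) (T x) = poissonInt s (fun _ => 1) x := by
  simp only [poissonInt, mul_one]
  rw [← integral_sphereProb_comp_isometry T
    (continuous_ballPoissonKernel_sphere (by rwa [T.norm_map]))]
  simp only [ballPoissonKernel, ← map_smul, ← map_sub, T.norm_map]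

theorem ballPoissonKernel_zero {F : Type*} [NormedAddCommGroup F] [InnerProductSpace ℝ F]
    {s : ℝ} (hs : 0 < s) {p : F} (hp : ‖p‖ = s) :
    ballPoissonKernel s 0 p = 1 := by
  simp [ballPoissonKernel, hp, hs.ne']

theorem poissonInt_zero {s : ℝ} (hs : 0 < s) (f : F → ℝ) :
    poissonInt s f 0 = ∫ ζ, f (s • (ζ : F)) ∂sphereProb F := by
  simp only [poissonInt, ballPoissonKernel_zero hs (norm_smul_sphere hs.le _), one_mul]

theorem poissonInt_one [Nontrivial F] {s : ℝ} {x : F} (hx : ‖x‖ < s) :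
    poissonInt s (fun _ => 1) x = 1 := by
  have hs : 0 < s := (norm_nonneg x).trans_lt hx
  set P : F → ℝ := poissonInt s fun _ => 1 with hP
  have hP0 : P 0 = 1 := by
    rw [hP, poissonInt_zero hs]
    simp
  have hsph : ∀ y : F, ‖y‖ = ‖x‖ → P y = P x := fun y hy => by
    rw [hP, ← poissonInt_one_isometry ((ℝ ∙ (y - x))ᗮ.reflection) (hy.trans_lt hx),
      Submodule.reflection_sub hy]
  have hsub : closedBall (0 : F) ‖x‖ ⊆ ball 0 s := closedBall_subset_ball hx
  have hPc : ContinuousOn P (closedBall 0 ‖x‖) :=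
    (continuousOn_poissonInt hs.le continuous_const).mono hsub
  have key : ∀ a : ℝ, ∀ η > 0, a * P 0 ≤ a * P x + η := by
    intro a η hη
    obtain ⟨l, hl, hlx⟩ : ∃ l : ℝ, 0 < l ∧ l * ‖x‖ ^ 2 ≤ η := by
      refine ⟨η / (‖x‖ ^ 2 + 1), by positivity, ?_⟩
      rw [div_mul_eq_mul_div, div_le_iff₀ (by positivity)]
      nlinarith
    have h := le_add_of_boundary_le (φ := fun y => ((a * P y : ℝ) : EReal))
      (G := fun y => 0 + (-l) * ‖y‖ ^ 2) (ε := a * P x + l * ‖x‖ ^ 2)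
      (ContinuousOn.upperSemicontinuousOn
        (continuous_coe_real_ereal.comp_continuousOn (continuousOn_const.mul hPc)))
      (by fun_prop) (fun _ _ => EReal.coe_ne_top _)
      (fun y hy => by
        rw [mem_sphere_zero_iff_norm] at hy
        rw [hsph y hy, hy]
        norm_cast
        linarith)
      (fun y hy c hc => by
        norm_cast at hc
        subst hc
        have hy' := mem_ball_zero_iff.1 hy
        obtain ⟨C, hC⟩ := ballMean_poissonInt (f := fun _ : F => (1 : ℝ)) continuous_const
          (hy'.trans hx)
        refine Eventually.frequently ?_
        filter_upwards [hC, eventually_mul_pow_three_lt (|a| * C)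
          (mul_pos hl (normSqMean_pos (F := F))), Ioo_mem_nhdsGT (sub_pos.2 hy')]
          with r h1 h2 ⟨hr, hr'⟩
        have hsub' : closedBall y r ⊆ closedBall 0 ‖x‖ := by
          refine closedBall_subset_closedBall' ?_
          rw [dist_zero_right]
          linarith
        have hPr := hPc.mono hsub'
        have haP : ContinuousOn (fun z => a * P z) (closedBall y r) := continuousOn_const.mul hPr
        rw [erealBallAvg_coe hr (integrableOn_ball_of_continuousOn haP),
          ballMean_add_normSq hr continuousOn_const]
        simp only [ballMean, setAverage_ball_const hr] at h1 ⊢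
        rw [setAverage_const_mul]
        norm_cast
        have h3 : |a * ((⨍ h in ball (0 : F) r, P (y + h)) - P y)| ≤ |a| * C * r ^ 3 := by
          rw [abs_mul, mul_assoc]
          gcongr
        have := (abs_le.1 h3).1
        nlinarith) 0 (mem_closedBall_self (norm_nonneg x))
    norm_cast at h
    simp only [norm_zero] at h
    linarith
  have h1 := le_of_forall_pos_le_add (key 1)
  have h2 := le_of_forall_pos_le_add (key (-1))
  linarith

theorem ballPoissonKernel_nonneg {F : Type*} [NormedAddCommGroup F] [InnerProductSpace ℝ F]
    {s : ℝ} {x p : F} (hx : ‖x‖ < s) :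
    0 ≤ ballPoissonKernel s x p := by
  have : ‖x‖ ^ 2 ≤ s ^ 2 := by gcongr
  have : 0 ≤ s ^ 2 - ‖x‖ ^ 2 := by linarith
  rw [ballPoissonKernel]
  positivity

theorem ballPoissonKernel_le {F : Type*} [NormedAddCommGroup F] [InnerProductSpace ℝ F]
    {s δ : ℝ} {x p : F} (hx : ‖x‖ < s) (hδ : 0 < δ)
    (hp : δ ≤ ‖x - p‖) :
    ballPoissonKernel s x p ≤
      (s ^ 2 - ‖x‖ ^ 2) / s ^ 2 * (δ ^ 2 / s ^ 2) ^ (-((Module.finrank ℝ F : ℝ) / 2)) := by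
  have hs : 0 < s := (norm_nonneg x).trans_lt hx
  have : ‖x‖ ^ 2 ≤ s ^ 2 := by gcongr
  have : 0 ≤ s ^ 2 - ‖x‖ ^ 2 := by linarith
  rw [ballPoissonKernel]
  refine mul_le_mul_of_nonneg_left ?_ (by positivity)
  refine Real.rpow_le_rpow_of_nonpos (by positivity) (by gcongr) ?_
  have : (0 : ℝ) ≤ (Module.finrank ℝ F : ℝ) / 2 := by positivity
  linarith

theorem eventually_le_poissonInt [Nontrivial F] {s ε : ℝ} (hs : 0 < s) (hε : 0 < ε) {f : F → ℝ}
    (hf : Continuous f) :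
    ∀ᶠ t in 𝓝[<] s, ∀ x : F, ‖x‖ = t → f x ≤ poissonInt s f x + ε := by
  obtain ⟨M, hM⟩ := (isCompact_closedBall (0 : F) s).exists_bound_of_continuousOn hf.continuousOn
  have hM0 : 0 ≤ M := (norm_nonneg _).trans (hM 0 (mem_closedBall_self hs.le))
  have huc := (isCompact_closedBall (0 : F) s).uniformContinuousOn_of_continuous hf.continuousOn
  obtain ⟨δ, hδ, hfδ⟩ := Metric.uniformContinuousOn_iff.1 huc (ε / 2) (half_pos hε)
  set B : ℝ → ℝ := fun t =>
    (s ^ 2 - t ^ 2) / s ^ 2 * (δ ^ 2 / s ^ 2) ^ (-((Module.finrank ℝ F : ℝ) / 2)) with hB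
  have hBlim : Tendsto (fun t => 2 * M * B t) (𝓝[<] s) (𝓝 0) := by
    have hc : Continuous fun t => 2 * M * B t := by fun_prop
    simpa [hB] using (hc.tendsto s).mono_left nhdsWithin_le_nhds
  filter_upwards [hBlim.eventually_lt_const (half_pos hε), Ioo_mem_nhdsLT hs]
    with t ht ⟨ht0, hts⟩ x hx
  have hxs : ‖x‖ < s := hx.trans_lt hts
  have hKc := continuous_ballPoissonKernel_sphere hxs
  have hpt : ∀ ζ : sphere (0 : F) 1,
      ballPoissonKernel s x (s • (ζ : F)) * f x - ballPoissonKernel s x (s • (ζ : F)) *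
        f (s • (ζ : F)) ≤ ballPoissonKernel s x (s • (ζ : F)) * (ε / 2) + 2 * M * B t := by
    intro ζ
    have hK := ballPoissonKernel_nonneg (p := s • (ζ : F)) hxs
    have hB0 : 0 ≤ B t := by
      have : t ^ 2 ≤ s ^ 2 := by gcongr
      have : 0 ≤ s ^ 2 - t ^ 2 := by linarith
      positivity
    have hxm : x ∈ closedBall (0 : F) s := mem_closedBall_zero_iff.2 hxs.le
    have hζm : s • (ζ : F) ∈ closedBall (0 : F) s :=
      mem_closedBall_zero_iff.2 (norm_smul_sphere hs.le ζ).le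
    rw [← mul_sub]
    rcases lt_or_ge (dist x (s • (ζ : F))) δ with h | h
    · have h1 := hfδ x hxm _ hζm h
      rw [Real.dist_eq] at h1
      have h2 := (abs_lt.1 h1).2
      have : 0 ≤ 2 * M * B t := by positivity
      nlinarith
    · rw [dist_eq_norm] at h
      have h1 := ballPoissonKernel_le hxs hδ h
      rw [hx] at h1
      have h2 := (abs_le.1 (hM x hxm)).2
      have h3 := (abs_le.1 (hM _ hζm)).1
      have h4 : ballPoissonKernel s x (s • (ζ : F)) * (f x - f (s • (ζ : F))) ≤ B t * (2 * M) :=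
        (mul_le_mul_of_nonneg_left (by linarith) hK).trans
          (mul_le_mul_of_nonneg_right h1 (by positivity))
      nlinarith
  have hi : Integrable (fun ζ : sphere (0 : F) 1 => ballPoissonKernel s x (s • (ζ : F)))
    (sphereProb F) := integrable_sphereProb hKc
  have hi2 : Integrable (fun ζ : sphere (0 : F) 1 =>
      ballPoissonKernel s x (s • (ζ : F)) * f (s • (ζ : F))) (sphereProb F) :=
    integrable_sphereProb (hKc.mul (by fun_prop))
  have h := integral_mono ((hi.mul_const _).sub hi2) ((hi.mul_const _).add (integrable_const _)) hpt
  have hone := poissonInt_one hxs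
  simp only [poissonInt, mul_one] at hone
  simp only [Pi.sub_apply, Pi.add_apply] at h
  rw [integral_sub (hi.mul_const _) hi2, integral_add (hi.mul_const _) (integrable_const _),
    integral_mul_const, integral_mul_const, hone, integral_const] at h
  simp only [probReal_univ, one_smul, one_mul] at h
  rw [poissonInt]
  linarith

/-- The sub-mean value inequality on spheres for a function whose upper Laplace parameter is
bounded below. -/
theorem le_sphere_mean [Nontrivial F] {φ : F → EReal} {f : F → ℝ} {s γ γ' : ℝ} (hs : 0 < s)
    (hγ : γ < γ') (hφ : UpperSemicontinuousOn φ (closedBall 0 s)) (hf : Continuous f)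
    (hφf : ∀ y ∈ closedBall (0 : F) s, φ y ≤ (f y : EReal))
    (hfreq : ∀ y ∈ ball (0 : F) s, ∀ c : ℝ, φ y = c →
      ∃ᶠ ρ in 𝓝[>] (0 : ℝ), ((c + γ' * ρ ^ 2 : ℝ) : EReal) < erealBallAvg φ y ρ)
    {c₀ : ℝ} (hc₀ : φ 0 = c₀) :
    c₀ ≤ (∫ ζ, f (s • (ζ : F)) ∂sphereProb F) - γ / normSqMean F * s ^ 2 := by
  have hκ := normSqMean_pos (F := F)
  set l := γ / normSqMean F with hl
  have hlκ : l * normSqMean F = γ := div_mul_cancel₀ _ hκ.ne'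
  refine le_of_forall_pos_le_add fun ε hε => ?_
  have key : ∀ᶠ t in 𝓝[<] s,
      c₀ ≤ (∫ ζ, f (s • (ζ : F)) ∂sphereProb F) - l * t ^ 2 + ε := by
    filter_upwards [eventually_le_poissonInt hs hε hf, Ioo_mem_nhdsLT hs] with t ht ⟨ht0, hts⟩
    have hsub : closedBall (0 : F) t ⊆ closedBall 0 s := closedBall_subset_closedBall hts.le
    have hsub' : closedBall (0 : F) t ⊆ ball 0 s := closedBall_subset_ball hts
    have hPc : ContinuousOn (poissonInt s f) (closedBall 0 t) :=
      (continuousOn_poissonInt hs.le hf).mono hsub'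
    have h := le_add_of_boundary_le (G := fun y => poissonInt s f y + l * ‖y‖ ^ 2)
      (ε := ε - l * t ^ 2) (hφ.mono hsub) (hPc.add (by fun_prop))
      (fun y hy => ne_top_of_le_ne_top (EReal.coe_ne_top _) (hφf y (hsub hy)))
      (fun y hy => by
        refine (hφf y (hsub (sphere_subset_closedBall hy))).trans ?_
        rw [mem_sphere_zero_iff_norm] at hy
        have := ht y hy
        rw [hy]
        norm_cast
        linarith)
      (fun y hy c hc => by
        have hy' := mem_ball_zero_iff.1 hy
        obtain ⟨C, hC⟩ := ballMean_poissonInt hf (hy'.trans hts)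
        refine ((hfreq y (ball_subset_ball hts.le hy) c hc).and_eventually
          (hC.and ((eventually_mul_pow_three_lt C (sub_pos.2 hγ)).and
            (Ioo_mem_nhdsGT (sub_pos.2 hy'))))).mono ?_
        rintro r ⟨h1, h2, h3, hr, hr'⟩
        refine lt_of_le_of_lt ?_ h1
        have hsub'' : closedBall y r ⊆ closedBall 0 t := by
          refine closedBall_subset_closedBall' ?_
          rw [dist_zero_right]
          linarith
        rw [ballMean_add_normSq hr (hPc.mono hsub'')]
        norm_cast
        have := (abs_le.1 h2).2
        nlinarith) 0 (mem_closedBall_self ht0.le)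
    rw [hc₀] at h
    norm_cast at h
    rw [poissonInt_zero hs] at h
    simp only [norm_zero] at h
    linarith
  have hlim : Tendsto (fun t : ℝ => (∫ ζ, f (s • (ζ : F)) ∂sphereProb F) - l * t ^ 2 + ε)
      (𝓝[<] s) (𝓝 ((∫ ζ, f (s • (ζ : F)) ∂sphereProb F) - l * s ^ 2 + ε)) := by
    have hc : Continuous fun t : ℝ =>
      (∫ ζ, f (s • (ζ : F)) ∂sphereProb F) - l * t ^ 2 + ε := by fun_prop
    exact (hc.tendsto s).mono_left nhdsWithin_le_nhds
  exact ge_of_tendsto hlim key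

theorem integral_toSphere (g : sphere (0 : F) 1 → ℝ) :
    ∫ ζ, g ζ ∂sphereProb F
      = ((volume : Measure F).toSphere.real univ)⁻¹ * ∫ ζ, g ζ ∂(volume : Measure F).toSphere := by
  rw [sphereProb, integral_smul_measure, ENNReal.toReal_inv, smul_eq_mul]
  rfl

/-- A function whose integrals over all spheres centered at the origin are nonnegative has
nonnegative integral. -/
theorem integral_nonneg_of_sphere [Nontrivial F] {g : F → ℝ} (hg : Integrable g)
    (h : ∀ t : ℝ, 0 < t → 0 ≤ ∫ ζ, g (t • (ζ : F)) ∂sphereProb F) : 0 ≤ ∫ x, g x := by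
  let H : sphere (0 : F) 1 × Ioi (0 : ℝ) → ℝ := fun z => g ((z.2 : ℝ) • (z.1 : F))
  have hH : H ∘ homeomorphUnitSphereProd F = fun x : ({0}ᶜ : Set F) => g x := by
    ext x
    have := congrArg Subtype.val ((homeomorphUnitSphereProd F).symm_apply_apply x)
    simp only [homeomorphUnitSphereProd_symm_apply_coe] at this
    simp only [Function.comp_apply, H, this]
  have hmp := (volume : Measure F).measurePreserving_homeomorphUnitSphereProd
  have hemb := (homeomorphUnitSphereProd F).measurableEmbedding
  have hgi : Integrable (fun x : ({0}ᶜ : Set F) => g x) ((volume : Measure F).comap (↑)) := by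
    have := (integrableOn_iff_comap_subtypeVal (measurableSet_singleton (0 : F)).compl).1
      hg.integrableOn
    exact this
  have hHi := (hmp.integrable_comp_emb hemb (g := H)).1 (by rwa [hH])
  have e1 : ∫ x, g x = ∫ x : ({0}ᶜ : Set F), g x ∂((volume : Measure F).comap (↑)) := by
    rw [integral_subtype_comap (measurableSet_singleton _).compl, restrict_compl_singleton]
  have e2 := hmp.integral_comp hemb H
  have e3 : ∀ x, H (homeomorphUnitSphereProd F x) = g x := fun x => congrFun hH x
  simp only [e3] at e2
  rw [e1, e2, integral_prod_symm _ hHi]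
  refine integral_nonneg fun t => ?_
  have h1 := h t t.2
  rw [integral_toSphere (fun ζ : sphere (0 : F) 1 => g ((t : ℝ) • (ζ : F)))] at h1
  have hpos : 0 < ((volume : Measure F).toSphere.real univ)⁻¹ := by
    refine inv_pos.2 (ENNReal.toReal_pos ?_ (measure_ne_top _ _))
    exact Measure.measure_univ_ne_zero.2 (Measure.toSphere_ne_zero _)
  exact nonneg_of_mul_nonneg_right h1 hpos

theorem setAverage_ball_nonneg_of_sphere [Nontrivial F] {g : F → ℝ} {R : ℝ} (hg : Continuous g)
    (h : ∀ t ∈ Ioo 0 R, 0 ≤ ∫ ζ, g (t • (ζ : F)) ∂sphereProb F) :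
    0 ≤ ⨍ x in ball (0 : F) R, g x := by
  rw [setAverage_eq, smul_eq_mul, ← integral_indicator measurableSet_ball]
  refine mul_nonneg (by positivity) (integral_nonneg_of_sphere ?_ fun t ht => ?_)
  · exact (integrable_indicator_iff measurableSet_ball).2
      (integrableOn_ball_of_continuousOn hg.continuousOn)
  · by_cases htR : t < R
    · have : ∀ ζ : sphere (0 : F) 1, (ball (0 : F) R).indicator g (t • (ζ : F))
          = g (t • (ζ : F)) := fun ζ => indicator_of_mem
        (by rw [mem_ball_zero_iff, norm_smul_sphere (le_of_lt ht)]; exact htR) _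
      simp only [this]
      exact h t ⟨ht, htR⟩
    · have : ∀ ζ : sphere (0 : F) 1, (ball (0 : F) R).indicator g (t • (ζ : F)) = 0 :=
        fun ζ => indicator_of_notMem
          (by rw [mem_ball_zero_iff, norm_smul_sphere (le_of_lt ht)]; exact htR) _
      simp only [this, integral_zero, le_refl]

theorem le_ballMean_zero [Nontrivial F] {φ : F → EReal} {f : F → ℝ} {R γ γ' : ℝ} (hR : 0 < R)
    (hγ : γ < γ') (hφ : UpperSemicontinuousOn φ (closedBall 0 R)) (hf : Continuous f)
    (hφf : ∀ y ∈ closedBall (0 : F) R, φ y ≤ (f y : EReal))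
    (hfreq : ∀ y ∈ ball (0 : F) R, ∀ c : ℝ, φ y = c →
      ∃ᶠ ρ in 𝓝[>] (0 : ℝ), ((c + γ' * ρ ^ 2 : ℝ) : EReal) < erealBallAvg φ y ρ) :
    φ 0 ≤ ((ballMean f 0 R - γ * R ^ 2 : ℝ) : EReal) := by
  have h0 := hφf 0 (mem_closedBall_self hR.le)
  induction hc : φ 0 with
  | bot => exact bot_le
  | top => simp [hc] at h0
  | coe c =>
    have hκ := normSqMean_pos (F := F)
    set l := γ / normSqMean F with hl
    have hlκ : l * normSqMean F = γ := div_mul_cancel₀ _ hκ.ne'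
    have hsph : ∀ t ∈ Ioo 0 R,
        0 ≤ ∫ ζ, (f (t • (ζ : F)) + (-l * ‖t • (ζ : F)‖ ^ 2 + -c)) ∂sphereProb F := by
      intro t ⟨ht, htR⟩
      have hsub : closedBall (0 : F) t ⊆ closedBall 0 R := closedBall_subset_closedBall htR.le
      have h := le_sphere_mean ht hγ (hφ.mono hsub) hf (fun y hy => hφf y (hsub hy))
        (fun y hy => hfreq y (ball_subset_ball htR.le hy)) hc
      simp only [norm_smul_sphere ht.le]
      rw [integral_add (integrable_sphereProb (by fun_prop)) (integrable_const _), integral_const]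
      simp only [probReal_univ, one_smul]
      linarith
    have h := setAverage_ball_nonneg_of_sphere
      (g := fun x => f x + (-l * ‖x‖ ^ 2 + -c)) (by fun_prop) hsph
    have hi : ∀ {g : F → ℝ}, Continuous g → IntegrableOn g (ball (0 : F) R) :=
      fun hg => integrableOn_ball_of_continuousOn hg.continuousOn
    rw [setAverage_add (hi hf) (hi (by fun_prop)), setAverage_add (hi (by fun_prop))
      (hi (by fun_prop)), setAverage_const_mul, setAverage_normSq hR, setAverage_ball_const hR] at h
    simp only [ballMean, zero_add]
    norm_cast
    nlinarith

theorem erealBallAvg_comp_add (φ : F → EReal) (x y : F) (r : ℝ) :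
    erealBallAvg (fun z => φ (x + z)) y r = erealBallAvg φ (x + y) r := by
  have h : ∀ g : F → ℝ≥0∞, ∫⁻ z in ball y r, g (x + z) = ∫⁻ z in ball (x + y) r, g z := by
    intro g
    have h1 := (measurePreserving_add_left (volume : Measure F) x).setLIntegral_comp_preimage_emb
      (measurableEmbedding_addLeft x) g (ball (x + y) r)
    rwa [show (fun z => x + z) ⁻¹' ball (x + y) r = ball y r by ext; simp] at h1
  simp only [erealBallAvg]
  rw [h fun z => erealToENNReal (φ z), h fun z => erealToENNReal (-φ z),
    Measure.addHaar_ball_center volume y, Measure.addHaar_ball_center volume (x + y)]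

/-- The sub-mean value inequality on balls for a function whose upper Laplace parameter is
bounded below. -/
theorem le_ballMean [Nontrivial F] {φ : F → EReal} {f : F → ℝ} {x : F} {R γ γ' : ℝ} (hR : 0 < R)
    (hγ : γ < γ') (hφ : UpperSemicontinuousOn φ (closedBall x R)) (hf : Continuous f)
    (hφf : ∀ y ∈ closedBall x R, φ y ≤ (f y : EReal))
    (hfreq : ∀ y ∈ ball x R, ∀ c : ℝ, φ y = c →
      ∃ᶠ ρ in 𝓝[>] (0 : ℝ), ((c + γ' * ρ ^ 2 : ℝ) : EReal) < erealBallAvg φ y ρ) :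
    φ x ≤ ((ballMean f x R - γ * R ^ 2 : ℝ) : EReal) := by
  have hmem : ∀ y ∈ closedBall (0 : F) R, x + y ∈ closedBall x R := fun y hy => by simpa using hy
  have h := le_ballMean_zero (φ := fun z => φ (x + z)) (f := fun z => f (x + z)) hR hγ
    (hφ.comp (g := fun z => x + z) (by fun_prop) hmem) (by fun_prop)
    (fun y hy => hφf _ (hmem y hy))
    (fun y hy c hc => by
      simp only [erealBallAvg_comp_add]
      exact hfreq (x + y) (by simpa using hy) c hc)
  simpa [ballMean] using h

theorem EReal.exists_real_gt_of_eventually {U : EReal} (hU : U < ⊤) {p : EReal → Prop}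
    (h : ∀ᶠ a in 𝓝 U, p a) : ∃ a : ℝ, U < a ∧ p a := by
  obtain ⟨w, hw, hsub⟩ := exists_Ico_subset_of_mem_nhds h ⟨⊤, hU⟩
  obtain ⟨a, h1, h2⟩ := EReal.lt_iff_exists_real_btwn.1 hw
  exact ⟨a, h1, hsub ⟨h1.le, h2⟩⟩

theorem limsup_ofReal_le_toENNReal {U : EReal} (hU : U < ⊤) {g : ℕ → ℝ}
    (h : ∀ a : ℝ, U < a → ∀ᶠ n in atTop, g n ≤ a) :
    limsup (fun n => ENNReal.ofReal (g n)) atTop ≤ U.toENNReal := by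
  refine le_of_forall_gt fun b hb => ?_
  obtain ⟨a, ha, hab⟩ := EReal.exists_real_gt_of_eventually hU
    (EReal.continuous_toENNReal.continuousAt.eventually_lt_const hb)
  rw [EReal.toENNReal_of_ne_top (EReal.coe_ne_top a), EReal.toReal_coe] at hab
  refine lt_of_le_of_lt (limsup_le_of_le (by isBoundedDefault) ?_) hab
  filter_upwards [h a ha] with n hn using ENNReal.ofReal_le_ofReal hn

theorem toENNReal_neg_le_liminf {U : EReal} (hU : U < ⊤) {g : ℕ → ℝ}
    (h : ∀ a : ℝ, U < a → ∀ᶠ n in atTop, g n ≤ a) :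
    (-U).toENNReal ≤ liminf (fun n => ENNReal.ofReal (-g n)) atTop := by
  refine le_of_forall_lt fun b hb => ?_
  obtain ⟨a, ha, hab⟩ := EReal.exists_real_gt_of_eventually hU
    ((EReal.continuous_toENNReal.comp continuous_neg).continuousAt.eventually_const_lt hb)
  rw [Function.comp_apply, ← EReal.coe_neg, EReal.toENNReal_of_ne_top (EReal.coe_ne_top _),
    EReal.toReal_coe] at hab
  refine hab.trans_le (le_liminf_of_le (by isBoundedDefault) ?_)
  filter_upwards [h a ha] with n hn using ENNReal.ofReal_le_ofReal (neg_le_neg hn)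

theorem le_erealBallAvg_of_approx {u : F → EReal} {f : ℕ → F → ℝ} {x : F} {R C c : ℝ}
    (hR : 0 < R) (hf : ∀ n, Continuous (f n)) (hfC : ∀ n, ∀ y ∈ ball x R, f n y ≤ C)
    (huC : ∀ y ∈ ball x R, u y ≤ C)
    (hfu : ∀ y ∈ ball x R, ∀ a : ℝ, u y < a → ∀ᶠ n in atTop, f n y ≤ a)
    (hc : ∀ n, c ≤ ballMean (f n) x R) : (c : EReal) ≤ erealBallAvg u x R := by
  set μ := (volume : Measure F).restrict (ball x R) with hμ
  have hv := volume_real_ball_pos x hR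
  have hfin : IsFiniteMeasure μ := ⟨by simpa [hμ] using measure_ball_lt_top⟩
  set P := ∫⁻ y, (u y).toENNReal ∂μ with hP
  set Q := ∫⁻ y, (-u y).toENNReal ∂μ with hQ
  have hae : ∀ {p : F → Prop}, (∀ y ∈ ball x R, p y) → ∀ᵐ y ∂μ, p y := fun h =>
    (ae_restrict_iff' measurableSet_ball).2 (.of_forall h)
  have hPfin : P ≠ ⊤ := by
    have h1 : P ≤ ∫⁻ _, ENNReal.ofReal C ∂μ := lintegral_mono_ae (hae fun y hy =>
      EReal.toENNReal_le_toENNReal (huC y hy))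
    refine (h1.trans_lt ?_).ne
    rw [lintegral_const]
    exact ENNReal.mul_lt_top ENNReal.ofReal_lt_top (measure_lt_top _ _)
  have hlimP : limsup (fun n => ∫⁻ y, ENNReal.ofReal (f n y) ∂μ) atTop ≤ P := by
    refine (limsup_lintegral_le (fun _ => ENNReal.ofReal C)
      (fun n => (hf n).measurable.ennreal_ofReal)
      (fun n => hae fun y hy => ENNReal.ofReal_le_ofReal (hfC n y hy)) ?_).trans
      (lintegral_mono_ae (hae fun y hy => ?_))
    · rw [lintegral_const]
      exact (ENNReal.mul_lt_top ENNReal.ofReal_lt_top (measure_lt_top _ _)).ne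
    · exact limsup_ofReal_le_toENNReal ((huC y hy).trans_lt (EReal.coe_lt_top C)) (hfu y hy)
  have hlimQ : Q ≤ liminf (fun n => ∫⁻ y, ENNReal.ofReal (-f n y) ∂μ) atTop := by
    refine (lintegral_mono_ae (hae fun y hy => ?_)).trans
      (lintegral_liminf_le fun n => (hf n).neg.measurable.ennreal_ofReal)
    exact toENNReal_neg_le_liminf ((huC y hy).trans_lt (EReal.coe_lt_top C)) (hfu y hy)
  have hfi : ∀ n, Integrable (f n) μ := fun n =>
    integrableOn_ball_of_continuousOn (hf n).continuousOn
  have hn : ∀ n, (∫⁻ y, ENNReal.ofReal (-f n y) ∂μ).toReal ≤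
      (∫⁻ y, ENNReal.ofReal (f n y) ∂μ).toReal - c * volume.real (ball x R) := by
    intro n
    have h := hc n
    rw [ballMean_eq, setAverage_eq, integral_eq_lintegral_pos_part_sub_lintegral_neg_part (hfi n),
      smul_eq_mul, inv_mul_eq_div, le_div_iff₀ hv] at h
    linarith
  have hQP : ∀ ε > 0, Q ≤ ENNReal.ofReal (P.toReal + ε - c * volume.real (ball x R)) ∧
      0 ≤ P.toReal + ε - c * volume.real (ball x R) := by
    intro ε hε
    have hlt : limsup (fun n => ∫⁻ y, ENNReal.ofReal (f n y) ∂μ) atTop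
        < ENNReal.ofReal (P.toReal + ε) := by
      refine hlimP.trans_lt ?_
      rw [← ENNReal.ofReal_toReal hPfin, ENNReal.ofReal_lt_ofReal_iff (by positivity)]
      simpa using hε
    have hev : ∀ᶠ n in atTop, (∫⁻ y, ENNReal.ofReal (-f n y) ∂μ).toReal ≤
        P.toReal + ε - c * volume.real (ball x R) := by
      filter_upwards [eventually_lt_of_limsup_lt hlt] with n h
      have := ENNReal.toReal_le_of_le_ofReal (by positivity) h.le
      linarith [hn n]
    refine ⟨hlimQ.trans ?_, ?_⟩
    · refine liminf_le_of_frequently_le' (hev.mono fun n h => ?_).frequently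
      exact (ENNReal.le_ofReal_iff_toReal_le (hfi n).neg.lintegral_lt_top.ne
        (ENNReal.toReal_nonneg.trans h)).2 h
    · obtain ⟨n, h⟩ := hev.exists
      exact ENNReal.toReal_nonneg.trans h
  have hQfin : Q ≠ ⊤ := ((hQP 1 one_pos).1.trans_lt ENNReal.ofReal_lt_top).ne
  have hQle : Q.toReal ≤ P.toReal - c * volume.real (ball x R) := by
    refine le_of_forall_pos_le_add fun ε hε => ?_
    have h := hQP ε hε
    have := ENNReal.toReal_le_of_le_ofReal h.2 h.1
    linarith
  have hv0 : volume (ball x R) ≠ 0 := (measure_ball_pos volume x hR).ne'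
  simp only [erealBallAvg, erealToENNReal_eq]
  rw [← EReal.coe_ennreal_toReal (ENNReal.div_ne_top hPfin hv0),
    ← EReal.coe_ennreal_toReal (ENNReal.div_ne_top hQfin hv0), ← EReal.coe_sub,
    EReal.coe_le_coe_iff, ENNReal.toReal_div, ENNReal.toReal_div, ← sub_div]
  exact (le_div_iff₀ hv).2 (by linarith)

theorem abs_ballMean_sub_le {f : F → ℝ} {K : NNReal} (hf : LipschitzWith K f) {R : ℝ}
    (hR : 0 < R) (y x : F) : |ballMean f y R - ballMean f x R| ≤ K * dist y x := by
  refine abs_setAverage_ball_sub_le hR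
    (integrableOn_ball_of_continuousOn (hf.continuous.comp (by fun_prop)).continuousOn)
    (integrableOn_ball_of_continuousOn (hf.continuous.comp (by fun_prop)).continuousOn)
    fun h _ => ?_
  have := hf.dist_le_mul (y + h) (x + h)
  rwa [Real.dist_eq, dist_add_right] at this

theorem limsup_le_ballMean_sub [Nontrivial F] {𝓕 : Set (F → EReal)} {f : F → ℝ} {K : NNReal}
    {x : F} {R₁ R γ γ' : ℝ} (hR : 0 < R) (hRR : R < R₁) (hγ : γ < γ')
    (husc : ∀ φ ∈ 𝓕, UpperSemicontinuousOn φ (closedBall x R₁))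
    (hfreq : ∀ φ ∈ 𝓕, ∀ y ∈ closedBall x R₁, ∀ c : ℝ, φ y = c →
      ∃ᶠ ρ in 𝓝[>] (0 : ℝ), ((c + γ' * ρ ^ 2 : ℝ) : EReal) < erealBallAvg φ y ρ)
    (hf : LipschitzWith K f) (hle : ∀ y ∈ closedBall x R₁, ⨆ φ ∈ 𝓕, φ y ≤ (f y : EReal)) :
    limsup (fun y => ⨆ φ ∈ 𝓕, φ y) (𝓝 x) ≤ ((ballMean f x R - γ * R ^ 2 : ℝ) : EReal) := by
  have key : ∀ ε > 0, limsup (fun y => ⨆ φ ∈ 𝓕, φ y) (𝓝 x)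
      ≤ ((ballMean f x R - γ * R ^ 2 + ε : ℝ) : EReal) := by
    intro ε hε
    refine limsup_le_of_le (by isBoundedDefault) ?_
    have hK : Tendsto (fun y => (K : ℝ) * dist y x) (𝓝 x) (𝓝 0) := by
      have : Continuous fun y => (K : ℝ) * dist y x := by fun_prop
      simpa using this.tendsto x
    filter_upwards [ball_mem_nhds x (sub_pos.2 hRR), hK.eventually_lt_const hε] with y hy hKy
    have hsub : closedBall y R ⊆ closedBall x R₁ :=
      closedBall_subset_closedBall' (by linarith [mem_ball.1 hy])
    have h1 := (abs_le.1 (abs_ballMean_sub_le hf hR y x)).2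
    refine iSup₂_le fun φ hφ => (le_ballMean hR hγ ((husc φ hφ).mono hsub) hf.continuous
      (fun z hz => (le_iSup₂ (f := fun φ (_ : φ ∈ 𝓕) => φ z) φ hφ).trans (hle z (hsub hz)))
      fun z hz => hfreq φ hφ z (hsub (ball_subset_closedBall hz))).trans
        (EReal.coe_le_coe_iff.2 (by linarith))
  refine EReal.le_of_forall_lt_iff_le.1 fun z hz => ?_
  have := key (z - (ballMean f x R - γ * R ^ 2)) (sub_pos.2 (EReal.coe_lt_coe_iff.1 hz))
  rwa [add_sub_cancel] at this

theorem le_erealBallAvg_limsup [Nontrivial F] {𝓕 : Set (F → EReal)} {u : F → EReal}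
    {x : F} {R₁ R γ γ' C a : ℝ} (hR : 0 < R) (hRR : R < R₁) (hγ : γ < γ') (hC : 0 ≤ C)
    (husc : ∀ φ ∈ 𝓕, UpperSemicontinuousOn φ (closedBall x R₁))
    (hbd : ∀ φ ∈ 𝓕, ∀ y ∈ closedBall x R₁, φ y ≤ C)
    (hfreq : ∀ φ ∈ 𝓕, ∀ y ∈ closedBall x R₁, ∀ c : ℝ, φ y = c →
      ∃ᶠ ρ in 𝓝[>] (0 : ℝ), ((c + γ' * ρ ^ 2 : ℝ) : EReal) < erealBallAvg φ y ρ)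
    (hu : ∀ y ∈ ball x R₁, u y = limsup (fun y => ⨆ φ ∈ 𝓕, φ y) (𝓝 y)) (ha : u x = a) :
    ((a + γ * R ^ 2 : ℝ) : EReal) ≤ erealBallAvg u x R := by
  set s : F → EReal := fun y => ⨆ φ ∈ 𝓕, φ y
  have hs : ∀ z ∈ closedBall x R₁, s z ≤ C := fun z hz => iSup₂_le fun φ hφ => hbd φ hφ z hz
  have hx : x ∈ ball x R₁ := mem_ball_self (hR.trans hRR)
  have hA : (closedBall x R₁).Nonempty := ⟨x, ball_subset_closedBall hx⟩
  have hsub : ball x R ⊆ ball x R₁ := ball_subset_ball hRR.le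
  refine le_erealBallAvg_of_approx hR (f := supConv s (closedBall x R₁)) (C := C)
    (fun n => (lipschitzWith_supConv hA hC hs n).continuous)
    (fun n y _ => supConv_le hA hC hs n y) (fun y hy => ?_) (fun y hy b hb => ?_) fun n => ?_
  · rw [hu y (hsub hy)]
    refine limsup_le_of_le (by isBoundedDefault) ?_
    filter_upwards [isOpen_ball.mem_nhds (hsub hy)] with z hz using hs z (ball_subset_closedBall hz)
  · rw [hu y (hsub hy)] at hb
    exact eventually_supConv_le hA hC hs ((eventually_lt_of_limsup_lt hb).mono fun _ h => h.le)
  · have h := limsup_le_ballMean_sub hR hRR hγ husc hfreq (lipschitzWith_supConv hA hC hs n)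
      fun y hy => le_supConv hC hs n hy
    rw [← hu x hx, ha, EReal.coe_le_coe_iff] at h
    linarith

theorem add_mul_sq_lt_of_lt {γ a ρ : ℝ} {A : EReal} (hρ : 0 < ρ)
    (h : (γ : EReal) < (((ρ ^ 2)⁻¹ : ℝ) : EReal) * (A - a)) :
    ((a + γ * ρ ^ 2 : ℝ) : EReal) < A := by
  have hk : 0 < (ρ ^ 2)⁻¹ := by positivity
  induction A with
  | bot => simp [EReal.coe_mul_bot_of_pos hk] at h
  | top => exact EReal.coe_lt_top _
  | coe b =>
    rw [← EReal.coe_sub, ← EReal.coe_mul, EReal.coe_lt_coe_iff, inv_mul_eq_div,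
      lt_div_iff₀ (by positivity)] at h
    exact EReal.coe_lt_coe_iff.2 (by linarith)

theorem le_inv_sq_mul_sub {γ a ρ : ℝ} {A : EReal} (hρ : 0 < ρ)
    (h : ((a + γ * ρ ^ 2 : ℝ) : EReal) ≤ A) :
    (γ : EReal) ≤ (((ρ ^ 2)⁻¹ : ℝ) : EReal) * (A - a) := by
  have hk : 0 < (ρ ^ 2)⁻¹ := by positivity
  induction A with
  | bot => exact (EReal.coe_ne_bot _ (le_bot_iff.1 h)).elim
  | top => simp [EReal.coe_mul_top_of_pos hk]
  | coe b =>
    rw [EReal.coe_le_coe_iff] at h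
    rw [← EReal.coe_sub, ← EReal.coe_mul, EReal.coe_le_coe_iff, inv_mul_eq_div,
      le_div_iff₀ (by positivity)]
    linarith

theorem frequently_lt_erealBallAvg_of_lt_upperLaplace {m : ℕ} {φ : F → EReal} {y : F}
    {c γ : ℝ} (hc : φ y = c) (h : ((2 * (m + 2) * γ : ℝ) : EReal) < upperLaplace m φ y) :
    ∃ᶠ ρ in 𝓝[>] (0 : ℝ), ((c + γ * ρ ^ 2 : ℝ) : EReal) < erealBallAvg φ y ρ := by
  have hM : (0 : EReal) ≤ ((2 * ((m : ℝ) + 2) : ℝ) : EReal) := EReal.coe_nonneg.2 (by positivity)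
  rw [upperLaplace, EReal.coe_mul] at h
  have hlt := lt_of_not_ge fun hle => h.not_ge (mul_le_mul_of_nonneg_left hle hM)
  refine ((frequently_lt_of_lt_limsup (by isBoundedDefault) hlt).and_eventually
    self_mem_nhdsWithin).mono fun ρ hρ => ?_
  rw [hc] at hρ
  exact add_mul_sq_lt_of_lt hρ.2 hρ.1

theorem le_upperLaplace_of_frequently {m : ℕ} {u : F → EReal} {x : F} {a γ : ℝ}
    (ha : u x = a)
    (h : ∃ᶠ ρ in 𝓝[>] (0 : ℝ), ((a + γ * ρ ^ 2 : ℝ) : EReal) ≤ erealBallAvg u x ρ) :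
    ((2 * (m + 2) * γ : ℝ) : EReal) ≤ upperLaplace m u x := by
  have hM : (0 : EReal) ≤ ((2 * ((m : ℝ) + 2) : ℝ) : EReal) := EReal.coe_nonneg.2 (by positivity)
  rw [upperLaplace, EReal.coe_mul]
  refine mul_le_mul_of_nonneg_left (le_limsup_of_frequently_le ?_) hM
  refine (h.and_eventually self_mem_nhdsWithin).mono fun ρ hρ => ?_
  rw [ha]
  exact le_inv_sq_mul_sub hρ.2 hρ.1

theorem frequently_erealBallAvg_ne_bot {m : ℕ} {φ : F → EReal} {x : F} (hφ : φ x = ⊥)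
    (h : upperLaplace m φ x ≠ ⊥) : ∃ᶠ ρ in 𝓝[>] (0 : ℝ), erealBallAvg φ x ρ ≠ ⊥ := by
  refine fun hev => h ?_
  have : (fun r : ℝ => (((r ^ 2)⁻¹ : ℝ) : EReal) * (erealBallAvg φ x r - φ x))
      =ᶠ[𝓝[>] 0] fun _ => ⊥ := by
    filter_upwards [hev, self_mem_nhdsWithin] with ρ hρ hpos
    rw [not_not.1 hρ, hφ, EReal.bot_sub]
    exact EReal.coe_mul_bot_of_pos (by have : 0 < ρ := hpos; positivity)
  rw [upperLaplace, limsup_congr this, limsup_const]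
  exact EReal.coe_mul_bot_of_pos (by positivity)

theorem upperLaplace_eq_top {m : ℕ} {u : F → EReal} {x : F} (hu : u x = ⊥)
    (h : ∃ᶠ ρ in 𝓝[>] (0 : ℝ), erealBallAvg u x ρ ≠ ⊥) : upperLaplace m u x = ⊤ := by
  have : limsup (fun r : ℝ => (((r ^ 2)⁻¹ : ℝ) : EReal) * (erealBallAvg u x r - u x))
      (𝓝[>] (0 : ℝ)) = ⊤ := by
    refine top_le_iff.1 (le_limsup_of_frequently_le ?_)
    refine (h.and_eventually self_mem_nhdsWithin).mono fun ρ hρ => ?_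
    have hpos : 0 < ρ := hρ.2
    rw [hu, EReal.sub_bot hρ.1, EReal.coe_mul_top_of_pos (by positivity)]
  rw [upperLaplace, this, EReal.coe_mul_top_of_pos (by positivity)]

theorem upperLaplace_eq_zero_of_subsingleton [Subsingleton F] {m : ℕ} {u : F → EReal} {x : F}
    {a : ℝ} (ha : u x = a) : upperLaplace m u x = 0 := by
  have hu : u = fun z => (((fun _ : F => a) z : ℝ) : EReal) :=
    funext fun z => by rw [Subsingleton.elim z x, ha]
  have : (fun r : ℝ => (((r ^ 2)⁻¹ : ℝ) : EReal) * (erealBallAvg u x r - u x))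
      =ᶠ[𝓝[>] 0] fun _ => 0 := by
    filter_upwards [self_mem_nhdsWithin] with ρ hρ
    have hpos : 0 < ρ := hρ
    rw [ha, hu, erealBallAvg_coe hpos (integrableOn_ball_of_continuousOn continuousOn_const),
      ballMean, setAverage_ball_const hpos, ← EReal.coe_sub, sub_self, EReal.coe_zero, mul_zero]
  rw [upperLaplace, limsup_congr this, limsup_const, mul_zero]

theorem erealBallAvg_eq_bot_of_subsingleton [Subsingleton F] {u : F → EReal} {x : F} {ρ : ℝ}
    (hρ : 0 < ρ) (hu : u x = ⊥) : erealBallAvg u x ρ = ⊥ := by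
  refine (EReal.eq_bot_iff_forall_lt _).2 fun b => ?_
  refine (erealBallAvg_mono (v := fun z => (((fun _ : F => b - 1) z : ℝ) : EReal))
    fun z _ => ?_).trans_lt ?_
  · rw [Subsingleton.elim z x, hu]
    exact bot_le
  · rw [erealBallAvg_coe hρ (integrableOn_ball_of_continuousOn continuousOn_const),
      ballMean, setAverage_ball_const hρ, EReal.coe_lt_coe_iff]
    linarith

theorem ne_bot_of_subsingleton [Subsingleton F] {m : ℕ} {φ : F → EReal} {x : F}
    (h : upperLaplace m φ x ≠ ⊥) : φ x ≠ ⊥ := by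
  intro hφ
  obtain ⟨ρ, hρ, hpos⟩ := ((frequently_erealBallAvg_ne_bot hφ h).and_eventually
    self_mem_nhdsWithin).exists
  exact hρ (erealBallAvg_eq_bot_of_subsingleton hpos hφ)

section Family

variable {Ω : Set F} {ψ : F → ℝ} {𝓕 : Set (F → EReal)} {m : ℕ} {x : F}

theorem le_upperLaplace_uscSup_of_eq_bot (hopen : IsOpen Ω) (hne : 𝓕.Nonempty) (hx : x ∈ Ω)
    (hlap : ∀ φ ∈ 𝓕, (ψ x : EReal) ≤ upperLaplace m φ x) (hu : uscSup Ω 𝓕 x = ⊥) :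
    (ψ x : EReal) ≤ upperLaplace m (uscSup Ω 𝓕) x := by
  obtain ⟨φ, hφ⟩ := hne
  have h := frequently_erealBallAvg_ne_bot (le_bot_iff.1 ((le_uscSup hφ hx).trans_eq hu))
    (ne_bot_of_le_ne_bot (EReal.coe_ne_bot _) (hlap φ hφ))
  obtain ⟨R, hR, hsub⟩ := Metric.isOpen_iff.1 hopen x hx
  rw [upperLaplace_eq_top hu]
  · exact le_top
  · refine (h.and_eventually (Ioo_mem_nhdsGT hR)).mono fun ρ hρ => ?_
    exact ne_bot_of_le_ne_bot hρ.1 (erealBallAvg_mono fun y hy =>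
      le_uscSup hφ (hsub (ball_subset_ball hρ.2.2.le hy)))

theorem le_upperLaplace_uscSup_of_subsingleton [Subsingleton F] (hne : 𝓕.Nonempty) (hx : x ∈ Ω)
    (hlap : ∀ φ ∈ 𝓕, (ψ x : EReal) ≤ upperLaplace m φ x) {a : ℝ} (hu : uscSup Ω 𝓕 x = a) :
    (ψ x : EReal) ≤ upperLaplace m (uscSup Ω 𝓕) x := by
  obtain ⟨φ, hφ⟩ := hne
  have h1 := ne_bot_of_subsingleton (ne_bot_of_le_ne_bot (EReal.coe_ne_bot _) (hlap φ hφ))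
  have h2 : φ x ≠ ⊤ := ne_top_of_le_ne_top (EReal.coe_ne_top a) ((le_uscSup hφ hx).trans_eq hu)
  rw [upperLaplace_eq_zero_of_subsingleton hu,
    ← upperLaplace_eq_zero_of_subsingleton (EReal.coe_toReal h2 h1).symm (m := m)]
  exact hlap φ hφ

theorem le_upperLaplace_uscSup_of_nontrivial [Nontrivial F] (hopen : IsOpen Ω)
    (hψ : LowerSemicontinuousOn ψ Ω) (husc : ∀ φ ∈ 𝓕, UpperSemicontinuousOn φ Ω) (hx : x ∈ Ω)
    (hbd : ∃ V ∈ 𝓝 x, ∃ C : ℝ, ∀ φ ∈ 𝓕, ∀ y ∈ V, φ y ≤ (C : EReal))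
    (hlap : ∀ φ ∈ 𝓕, ∀ y ∈ Ω, (ψ y : EReal) ≤ upperLaplace m φ y) {a : ℝ}
    (hu : uscSup Ω 𝓕 x = a) : (ψ x : EReal) ≤ upperLaplace m (uscSup Ω 𝓕) x := by
  refine EReal.ge_of_forall_gt_iff_ge.1 fun c hc => ?_
  rw [EReal.coe_lt_coe_iff] at hc
  obtain ⟨c', hcc', hc'⟩ := exists_between hc
  have hM : (0 : ℝ) < 2 * (m + 2) := by positivity
  obtain ⟨V, hV, C, hC⟩ := hbd
  have hψ' := hψ x hx c' hc'
  rw [hopen.nhdsWithin_eq hx] at hψ'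
  obtain ⟨R₁, hR₁, hsub⟩ := nhds_basis_closedBall.mem_iff.1
    (inter_mem (inter_mem hV (hopen.mem_nhds hx)) hψ')
  have hΩ : closedBall x R₁ ⊆ Ω := fun y hy => (hsub hy).1.2
  have h : ∀ᶠ R in 𝓝[>] (0 : ℝ), ((a + c / (2 * (m + 2)) * R ^ 2 : ℝ) : EReal)
      ≤ erealBallAvg (uscSup Ω 𝓕) x R := by
    filter_upwards [Ioo_mem_nhdsGT hR₁] with R hR
    refine le_erealBallAvg_limsup hR.1 hR.2 (div_lt_div_of_pos_right hcc' hM) (le_max_right C 0)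
      (fun φ hφ => (husc φ hφ).mono hΩ) (fun φ hφ y hy => (hC φ hφ y (hsub hy).1.1).trans
        (EReal.coe_le_coe_iff.2 (le_max_left C 0))) (fun φ hφ y hy b hb => ?_)
      (fun y hy => by rw [uscSup, hopen.nhdsWithin_eq (hΩ (ball_subset_closedBall hy))]) hu
    refine frequently_lt_erealBallAvg_of_lt_upperLaplace (m := m) hb
      (lt_of_lt_of_le ?_ (hlap φ hφ y (hΩ hy)))
    rw [mul_div_cancel₀ _ hM.ne', EReal.coe_lt_coe_iff]
    exact (hsub hy).2
  have := le_upperLaplace_of_frequently (m := m) hu h.frequently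
  rwa [mul_div_cancel₀ _ hM.ne'] at this

theorem le_upperLaplace_uscSup (hopen : IsOpen Ω) (hψ : LowerSemicontinuousOn ψ Ω)
    (hne : 𝓕.Nonempty) (husc : ∀ φ ∈ 𝓕, UpperSemicontinuousOn φ Ω) (hx : x ∈ Ω)
    (hbd : ∃ V ∈ 𝓝 x, ∃ C : ℝ, ∀ φ ∈ 𝓕, ∀ y ∈ V, φ y ≤ (C : EReal))
    (hlap : ∀ φ ∈ 𝓕, ∀ y ∈ Ω, (ψ y : EReal) ≤ upperLaplace m φ y) :
    (ψ x : EReal) ≤ upperLaplace m (uscSup Ω 𝓕) x := by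
  have hlapx := fun φ hφ => hlap φ hφ x hx
  by_cases hbot : uscSup Ω 𝓕 x = ⊥
  · exact le_upperLaplace_uscSup_of_eq_bot hopen hne hx hlapx hbot
  have hu := (EReal.coe_toReal (uscSup_lt_top hbd).ne hbot).symm
  rcases subsingleton_or_nontrivial F
  · exact le_upperLaplace_uscSup_of_subsingleton hne hx hlapx hu
  · exact le_upperLaplace_uscSup_of_nontrivial hopen hψ husc hx hbd hlap hu

end Family

end BallMean

/-- Theorem (statement 13): let `Ω ⊆ ℝᵐ` be a domain, `ψ` lower semicontinuous on `Ω`, and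
`𝓕` a nonempty family of upper semicontinuous functions on `Ω`, locally uniformly bounded
above, with `Δ̄φ ≥ ψ` on `Ω` for every `φ ∈ 𝓕`. Then the upper semicontinuous regularization
`φ*` of the pointwise supremum of the family satisfies `Δ̄φ* ≥ ψ` on `Ω`. -/
theorem upperLaplace_sup_family (m : ℕ) (Ω : Set (EuclideanSpace ℝ (Fin m)))
    (hopen : IsOpen Ω) (hconn : IsConnected Ω)
    (ψ : EuclideanSpace ℝ (Fin m) → ℝ) (hψ : LowerSemicontinuousOn ψ Ω)
    (𝓕 : Set (EuclideanSpace ℝ (Fin m) → EReal)) (h𝓕ne : 𝓕.Nonempty)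
    (husc : ∀ φ ∈ 𝓕, UpperSemicontinuousOn φ Ω)
    (hbd : ∀ x ∈ Ω, ∃ V ∈ 𝓝 x, ∃ C : ℝ, ∀ φ ∈ 𝓕, ∀ y ∈ V, φ y ≤ (C : EReal))
    (hlap : ∀ φ ∈ 𝓕, ∀ x ∈ Ω, ((ψ x : ℝ) : EReal) ≤ upperLaplace m φ x) :
    ∀ x ∈ Ω,
      ((ψ x : ℝ) : EReal) ≤
        upperLaplace m
          (fun x => Filter.limsup (fun y => ⨆ φ ∈ 𝓕, φ y) (𝓝[Ω] x)) x := by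
  exact fun x hx => le_upperLaplace_uscSup hopen hψ h𝓕ne husc hx (hbd x hx) hlap

end
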